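/- arXiv:2201.00165 — 4 statements merged into one kernel-verified Lean document; each statement's English description precedes it below -/
import Mathlib

section
/- Let Q be a 2-regular bipartite graph with parts X and Z, each of size m ≥ 3. The number of perfect matchings of the bipartite complement of Q (i.e., the number of bijections σ: X → Z with xσ(x) ∉ E(Q) for all x) is at least (m!/m^m)·(m-2)^m. -/
open Finset
open scoped Classical

theorem Multiset.prod_one_add_le_pow_mul_exp (s : Multiset ℝ) {l t : ℝ} (hl : 0 < l) (ht : 0 ≤ t)
    (hs : ∀ c ∈ s, 0 ≤ c) :
    (s.map fun c => 1 + t * c).prod ≤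
      l ^ s.card * Real.exp ((s.card + t * s.sum) / l - s.card) := by
  induction s using Multiset.induction_on with
  | empty => simp
  | cons a s ih =>
    have ha : 0 ≤ a := hs a (Multiset.mem_cons_self a s)
    have ih' := ih fun c hc => hs c (Multiset.mem_cons_of_mem hc)
    have h1 : 1 + t * a ≤ l * Real.exp ((1 + t * a) / l - 1) := by
      have h := Real.add_one_le_exp ((1 + t * a) / l - 1)
      calc 1 + t * a = l * ((1 + t * a) / l - 1 + 1) := by field_simp; ring
        _ ≤ _ := by gcongr
    have h0 : 0 ≤ (s.map fun c => 1 + t * c).prod := by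
      apply Multiset.prod_nonneg
      intro x hx
      obtain ⟨c, hc, rfl⟩ := Multiset.mem_map.1 hx
      have := hs c (Multiset.mem_cons_of_mem hc)
      positivity
    rw [Multiset.map_cons, Multiset.prod_cons, Multiset.card_cons, Multiset.sum_cons]
    calc (1 + t * a) * (s.map fun c => 1 + t * c).prod
        ≤ (l * Real.exp ((1 + t * a) / l - 1)) *
            (l ^ s.card * Real.exp ((s.card + t * s.sum) / l - s.card)) := by
          apply mul_le_mul h1 ih' h0
          positivity
      _ = _ := by
          rw [mul_mul_mul_comm, ← Real.exp_add, pow_succ']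
          congr 2
          push_cast
          ring

theorem Multiset.prod_one_add_le_pow (s : Multiset ℝ) (n : ℕ) (hn : n ≠ 0) (hcard : s.card ≤ n + 1)
    (hs : ∀ c ∈ s, 0 ≤ c) (hsum : 0 < s.sum) :
    (s.map fun c => 1 + ((n + 1) / (n * s.sum)) * c).prod ≤ ((n + 1) / n : ℝ) ^ (n + 1) := by
  have hn0 : (0 : ℝ) < n := by positivity
  have key := Multiset.prod_one_add_le_pow_mul_exp s (l := (n + 1) / n)
    (t := (n + 1) / (n * s.sum)) (by positivity) (by positivity) hs
  refine key.trans ?_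
  obtain ⟨d, hd⟩ := Nat.exists_eq_add_of_le hcard
  have hd' : (n : ℝ) + 1 = s.card + d := by exact_mod_cast hd
  have hexp : (s.card + (n + 1) / (n * s.sum) * s.sum) / ((n + 1) / n) - s.card
      = (d : ℝ) * (1 - n / (n + 1)) := by
    have : (s.card : ℝ) = n + 1 - d := by linarith
    rw [this]
    field_simp
    ring
  have hle : Real.exp (1 - n / (n + 1)) ≤ (n + 1) / n := by
    have h := Real.one_sub_le_exp_neg (1 - n / (n + 1) : ℝ)
    have h2 : (n / (n + 1) : ℝ) ≤ Real.exp (-(1 - n / (n + 1))) := by linarith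
    rw [Real.exp_neg] at h2
    rw [← inv_div (n : ℝ) (n + 1)]
    exact le_inv_of_le_inv₀ (by positivity) h2
  rw [hexp, Real.exp_nat_mul, hd, pow_add]
  gcongr

open Polynomial in
theorem Polynomial.mul_pow_le_coeff_one_of_real_rooted (n : ℕ) (g : ℝ[X])
    (hdeg : g.natDegree ≤ n + 1)
    (hroots : n ≠ 0 → ∀ w : ℂ, aeval w g = 0 → w.im = 0 ∧ w.re < 0)
    (C : ℝ) (h : ∀ t : ℝ, 0 < t → C * t ≤ g.eval t) (hC : 0 < C) :
    C * (n / (n + 1) : ℝ) ^ n ≤ g.coeff 1 := by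
  rcases eq_or_ne n 0 with rfl | hn
  · rw [pow_zero, mul_one]
    by_contra! hlt
    have hg : ∀ t : ℝ, g.eval t = g.coeff 0 + g.coeff 1 * t := by
      intro t
      rw [eval_eq_sum_range' (n := 2) (by lia)]
      simp [Finset.sum_range_succ]
    have hpos : 0 < C - g.coeff 1 := by linarith
    have := h ((|g.coeff 0| + 1) / (C - g.coeff 1)) (by positivity)
    rw [hg] at this
    have h2 : (C - g.coeff 1) * ((|g.coeff 0| + 1) / (C - g.coeff 1)) = |g.coeff 0| + 1 := by
      field_simp
    have := le_abs_self (g.coeff 0)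
    linarith
  have hr := hroots hn
  have hsplit : g.Splits := by
    apply Splits.of_splits_map (algebraMap ℝ ℂ) (IsAlgClosed.splits _)
    intro a ha
    have h0 : aeval a g = 0 := by
      have := isRoot_of_mem_roots ha
      rwa [IsRoot, eval_map_algebraMap] at this
    refine ⟨a.re, Complex.ext ?_ ?_⟩ <;> simp [(hr a h0).1]
  have hneg : ∀ r ∈ g.roots, r < 0 := by
    intro r hrr
    have h0 : aeval (r : ℂ) g = 0 := by
      have h1 := isRoot_of_mem_roots hrr
      have := aeval_algebraMap_apply ℂ r g
      simpa [h1.eq_zero] using this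
    simpa using (hr r h0).2
  have h00 : g.eval 0 ≠ 0 := by
    intro h0
    have : aeval (0 : ℂ) g = 0 := by
      have := aeval_algebraMap_apply ℂ (0 : ℝ) g
      simpa [h0] using this
    simpa using (hr 0 this).2
  have h0 : 0 < g.eval 0 := by
    have hge : 0 ≤ g.eval 0 := by
      have ht : Filter.Tendsto (fun t => g.eval t) (nhdsWithin 0 (Set.Ioi 0)) (nhds (g.eval 0)) :=
        g.continuous.continuousWithinAt
      refine ge_of_tendsto ht ?_
      filter_upwards [self_mem_nhdsWithin] with t ht
      exact (mul_pos hC ht).le.trans (h t ht)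
    exact lt_of_le_of_ne hge h00.symm
  set s : Multiset ℝ := g.roots.map fun r => -r⁻¹ with hs
  have hspos : ∀ c ∈ s, 0 ≤ c := by
    intro c hc
    obtain ⟨r, hrr, rfl⟩ := Multiset.mem_map.1 hc
    have := inv_neg''.2 (hneg r hrr)
    linarith
  have hsum : g.coeff 1 = g.eval 0 * s.sum := by
    have := hsplit.eval_derivative_eq_eval_mul_sum h00
    rw [← coeff_zero_eq_eval_zero, coeff_derivative] at this
    simpa [hs] using this
  have heval : ∀ t, g.eval t = g.eval 0 * (s.map fun c => 1 + t * c).prod := by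
    intro t
    rw [hsplit.eval_eq_prod_roots t, hsplit.eval_eq_prod_roots 0, mul_assoc, hs, Multiset.map_map,
      ← Multiset.prod_map_mul]
    congr 2
    apply Multiset.map_congr rfl
    intro r hrr
    have := (hneg r hrr).ne
    simp only [Function.comp]
    field_simp
    ring
  have hcard : s.card ≤ n + 1 := by
    rw [hs, Multiset.card_map]
    exact (card_roots' g).trans hdeg
  have hsumpos : 0 < s.sum := by
    refine lt_of_le_of_ne (Multiset.sum_nonneg hspos) fun hz => ?_
    have hall : ∀ c ∈ s, c = 0 := (Multiset.all_zero_of_le_zero_le_of_sum_eq_zero hspos) hz.symm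
    have hconst : ∀ t, g.eval t = g.eval 0 := by
      intro t
      rw [heval t, Multiset.map_congr rfl (g := fun _ => (1 : ℝ)) ?_]
      · simp
      · intro c hc
        simp [hall c hc]
    have := h ((g.eval 0 + 1) / C) (by positivity)
    rw [hconst ((g.eval 0 + 1) / C), mul_div_cancel₀ _ hC.ne'] at this
    linarith
  have hn0 : (0 : ℝ) < n := by positivity
  have hb := h ((n + 1) / (n * s.sum)) (by positivity)
  rw [heval] at hb
  have hb2 := hb.trans (mul_le_mul_of_nonneg_left
    (Multiset.prod_one_add_le_pow s n hn hcard hspos hsumpos) h0.le)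
  rw [hsum]
  have e : C * ((n + 1) / (n * s.sum)) * (s.sum * (n / (n + 1)) ^ (n + 1)) =
      C * (n / (n + 1)) ^ n := by
    rw [pow_succ]; field_simp
  have e2 : g.eval 0 * ((n + 1) / n) ^ (n + 1) * (s.sum * (n / (n + 1)) ^ (n + 1)) =
      g.eval 0 * s.sum := by
    rw [mul_mul_mul_comm, mul_comm (_ ^ _) (_ ^ _), mul_comm]
    have : ((n : ℝ) / (n + 1)) ^ (n + 1) * ((n + 1) / n) ^ (n + 1) = 1 := by
      rw [← mul_pow]; field_simp; simp
    rw [this, one_mul]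
  rw [← e, ← e2]
  gcongr

namespace MvPolynomial

/-- A real polynomial is half-plane stable if it does not vanish at any point of the closed right
half-plane having at least one coordinate in the open right half-plane. -/
def HalfPlaneStable {n : ℕ} (P : MvPolynomial (Fin n) ℝ) : Prop :=
  ∀ z : Fin n → ℂ, (∀ j, 0 ≤ (z j).re) → (∃ j, 0 < (z j).re) → aeval z P ≠ 0

theorem aeval_cons_eq_eval_map_finSuccEquiv {n : ℕ} (P : MvPolynomial (Fin (n + 1)) ℝ) (w : ℂ)
    (z : Fin n → ℂ) :
    aeval (Fin.cons w z : Fin (n + 1) → ℂ) P =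
      ((finSuccEquiv ℝ n P).map (aeval z : MvPolynomial (Fin n) ℝ →ₐ[ℝ] ℂ).toRingHom).eval w := by
  induction P using MvPolynomial.induction_on with
  | C a => simp [finSuccEquiv_apply]
  | add p q hp hq => simp [hp, hq]
  | mul_X p i hp =>
    rw [map_mul, hp, map_mul, Polynomial.map_mul, Polynomial.eval_mul]
    congr 1
    refine Fin.cases ?_ (fun j => ?_) i
    · simp [finSuccEquiv_X_zero]
    · simp [finSuccEquiv_X_succ]

theorem IsHomogeneous.aeval_mul_apply {σ : Type*} {P : MvPolynomial σ ℝ} {k : ℕ}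
    (hP : P.IsHomogeneous k) (c : ℂ) (z : σ → ℂ) :
    MvPolynomial.aeval (fun j => c * z j) P = c ^ k * MvPolynomial.aeval z P := by
  rw [aeval_def, aeval_def, eval₂_eq, eval₂_eq, Finset.mul_sum]
  refine Finset.sum_congr rfl fun d hd => ?_
  rw [hP.degree_eq_sum_deg_support hd]
  simp_rw [mul_pow]
  rw [Finset.prod_mul_distrib, Finset.prod_pow_eq_pow_sum]
  ring

theorem HalfPlaneStable.coeff_finSuccEquiv_ne_zero {n k : ℕ} {P : MvPolynomial (Fin (n + 1)) ℝ}
    (hs : P.HalfPlaneStable) (hP : P.IsHomogeneous k) (z : Fin n → ℂ) :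
    aeval z ((finSuccEquiv ℝ n P).coeff k) ≠ 0 := by
  have hc := hP.finSuccEquiv_coeff_isHomogeneous k 0 (add_zero k)
  have hdeg : ∀ q : MvPolynomial (Fin n) ℝ, q.IsHomogeneous 0 → q = C (coeff 0 q) := fun q hq =>
    totalDegree_eq_zero_iff_eq_C.1 (Nat.le_zero.1 hq.totalDegree_le)
  have h1 : aeval (Fin.cons 1 0 : Fin (n + 1) → ℂ) P ≠ 0 := by
    apply hs
    · intro j
      refine Fin.cases ?_ (fun j => ?_) j <;> simp
    · exact ⟨0, by simp⟩
  rw [aeval_cons_eq_eval_map_finSuccEquiv, Polynomial.eval_map, Polynomial.eval₂_eq_sum,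
    Polynomial.sum] at h1
  obtain ⟨i, -, hi⟩ := Finset.exists_ne_zero_of_sum_ne_zero h1
  have hi' : coeff 0 ((finSuccEquiv ℝ n P).coeff i) ≠ 0 := by
    intro h0
    apply hi
    have : aeval (0 : Fin n → ℂ) ((finSuccEquiv ℝ n P).coeff i) = 0 := by
      rw [show (0 : Fin n → ℂ) = fun _ => 0 from rfl, aeval_zero']
      simp [constantCoeff_eq, h0]
    simpa using this
  have hik : i = k := by
    by_contra hne
    rw [finSuccEquiv_coeff_coeff] at hi'
    refine hi' (hP.coeff_eq_zero ?_)
    rwa [Finsupp.degree_eq_sum, Fin.sum_univ_succ, Finsupp.cons_zero, Finset.sum_eq_zero, add_zero]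
    intro j _
    simp
  subst hik
  rw [hdeg _ hc, aeval_C]
  simpa using hi'

theorem HalfPlaneStable.coeff_one_finSuccEquiv {n k : ℕ} {P : MvPolynomial (Fin (n + 1)) ℝ}
    (hs : P.HalfPlaneStable) (hP : P.IsHomogeneous k) (hk : k ≠ 0) :
    ((finSuccEquiv ℝ n P).coeff 1).HalfPlaneStable := by
  intro z hz hz'
  set G : Polynomial ℂ :=
    (finSuccEquiv ℝ n P).map (aeval z : MvPolynomial (Fin n) ℝ →ₐ[ℝ] ℂ).toRingHom with hG
  have hne : ∀ w : ℂ, 0 ≤ w.re → G.eval w ≠ 0 := by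
    intro w hw
    rw [hG, ← aeval_cons_eq_eval_map_finSuccEquiv]
    apply hs
    · intro j
      exact Fin.cases (by simpa using hw) (fun j => by simpa using hz j) j
    · obtain ⟨j, hj⟩ := hz'
      exact ⟨j.succ, by simpa using hj⟩
  have hcoeff : ∀ i, G.coeff i = aeval z ((finSuccEquiv ℝ n P).coeff i) := by
    intro i
    rw [hG, Polynomial.coeff_map]
    rfl
  have hdeg : G.natDegree ≠ 0 := by
    have : k ≤ G.natDegree := by
      apply Polynomial.le_natDegree_of_ne_zero
      rw [hcoeff]
      exact hs.coeff_finSuccEquiv_ne_zero hP z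
    lia
  have h0 := hne 0 (by simp)
  have hsplit : G.Splits := IsAlgClosed.splits G
  have hd := hsplit.eval_derivative_eq_eval_mul_sum h0
  rw [← hcoeff]
  have e : G.derivative.eval 0 = G.coeff 1 := by
    rw [← Polynomial.coeff_zero_eq_eval_zero, Polynomial.coeff_derivative]
    simp
  rw [← e, hd]
  refine mul_ne_zero h0 fun hsum => ?_
  have hpos : ∀ r ∈ G.roots, 0 < (1 / (0 - r)).re := by
    intro r hr
    have hr0 : r.re < 0 := by
      by_contra! hge
      exact hne r hge (Polynomial.isRoot_of_mem_roots hr)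
    have hr1 : r ≠ 0 := by
      rintro rfl
      simp at hr0
    rw [zero_sub, one_div, Complex.inv_re]
    exact div_pos (by simpa using hr0) (Complex.normSq_pos.2 (neg_ne_zero.2 hr1))
  have hroots : G.roots ≠ 0 := hsplit.roots_ne_zero hdeg
  have hre : ((G.roots.map fun r => 1 / (0 - r)).sum).re =
      (G.roots.map fun r => (1 / (0 - r)).re).sum := by
    have := map_multiset_sum Complex.reAddGroupHom (G.roots.map fun r => 1 / (0 - r))
    rw [Multiset.map_map] at this
    exact this
  have : 0 < (G.roots.map fun r => (1 / (0 - r)).re).sum := by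
    obtain ⟨a, ha⟩ := Multiset.exists_mem_of_ne_zero hroots
    obtain ⟨t, ht⟩ := Multiset.exists_cons_of_mem ha
    rw [ht, Multiset.map_cons, Multiset.sum_cons]
    refine add_pos_of_pos_of_nonneg (hpos a ha) (Multiset.sum_nonneg ?_)
    intro x hx
    obtain ⟨r, hr, rfl⟩ := Multiset.mem_map.1 hx
    exact (hpos r (ht ▸ Multiset.mem_cons_of_mem hr)).le
  rw [← hre, hsum] at this
  simp at this

theorem HalfPlaneStable.real_rooted {n k : ℕ} {P : MvPolynomial (Fin (n + 1)) ℝ}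
    (hs : P.HalfPlaneStable) (hP : P.IsHomogeneous k) (hn : n ≠ 0) {x : Fin n → ℝ}
    (hx : ∀ j, 0 < x j) {w : ℂ}
    (hw : Polynomial.aeval w ((finSuccEquiv ℝ n P).map (eval x)) = 0) : w.im = 0 ∧ w.re < 0 := by
  have hw' : aeval (Fin.cons w (fun j => (x j : ℂ)) : Fin (n + 1) → ℂ) P = 0 := by
    rw [aeval_cons_eq_eval_map_finSuccEquiv, ← hw, Polynomial.aeval_def,
      Polynomial.eval₂_eq_eval_map, Polynomial.map_map]
    congr 2
    ext q <;> simp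
  obtain ⟨c, hc⟩ : ∃ c : ℂ, w = c * c := ⟨w ^ (1 / 2 : ℂ), by
    rw [← sq]
    simp⟩
  by_contra hcon
  have hcre : c.re ≠ 0 := by
    intro h0
    have hre : w.re = -(c.im * c.im) := by simp [hc, h0]
    have him : w.im = 0 := by simp [hc, h0]
    have hw0 : w.re = 0 := by
      by_contra hne
      exact hcon ⟨him, lt_of_le_of_ne (by rw [hre]; nlinarith [mul_self_nonneg c.im]) hne⟩
    refine hs _ ?_ ?_ hw'
    · intro j
      exact Fin.cases (by simp [hw0]) (fun j => by simpa using (hx j).le) j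
    · obtain ⟨m, rfl⟩ := Nat.exists_eq_succ_of_ne_zero hn
      exact ⟨Fin.succ 0, by simpa using hx 0⟩
  obtain ⟨d, hd, hdre⟩ : ∃ d : ℂ, w = d * d ∧ 0 < d.re := by
    rcases lt_or_gt_of_ne hcre with h | h
    · exact ⟨-c, by simpa using hc, by simpa using h⟩
    · exact ⟨c, hc, h⟩
  have hd0 : d ≠ 0 := by
    rintro rfl
    simp at hdre
  have hscale := hP.aeval_mul_apply d⁻¹ (Fin.cons w (fun j => (x j : ℂ)) : Fin (n + 1) → ℂ)
  rw [hw', mul_zero] at hscale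
  have hdinv : 0 < d⁻¹.re := by
    rw [Complex.inv_re]
    exact div_pos hdre (Complex.normSq_pos.2 hd0)
  refine hs _ ?_ ?_ hscale
  · intro j
    refine Fin.cases ?_ (fun j => ?_) j
    · rw [Fin.cons_zero, hd, inv_mul_cancel_left₀ hd0]
      exact hdre.le
    · rw [Fin.cons_succ, Complex.re_mul_ofReal]
      exact (mul_pos hdinv (hx j)).le
  · refine ⟨0, ?_⟩
    rw [Fin.cons_zero, hd, inv_mul_cancel_left₀ hd0]
    exact hdre

/-- Gurvits' capacity inequality. -/
theorem HalfPlaneStable.capacity_mul_le_coeff {n : ℕ} {P : MvPolynomial (Fin n) ℝ}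
    (hs : P.HalfPlaneStable) (hP : P.IsHomogeneous n) {K : ℝ} (hK : 0 < K)
    (hcap : ∀ x : Fin n → ℝ, (∀ j, 0 < x j) → K * ∏ j, x j ≤ eval x P) :
    K * (n.factorial / (n : ℝ) ^ n) ≤ coeff (Finsupp.equivFunOnFinite.symm fun _ => 1) P := by
  induction n generalizing K with
  | zero =>
    have h := hcap Fin.elim0 fun j => j.elim0
    rw [eq_C_of_isEmpty P] at h ⊢
    have h0 : (Finsupp.equivFunOnFinite.symm fun _ => 1 : Fin 0 →₀ ℕ) = 0 := Subsingleton.elim _ _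
    simpa [h0] using h
  | succ n ih =>
    have hq := hs.coeff_one_finSuccEquiv hP n.succ_ne_zero
    have hqh := hP.finSuccEquiv_coeff_isHomogeneous 1 n (add_comm 1 n)
    have hfac : (0 : ℝ) < (n / (n + 1)) ^ n := by
      rcases eq_or_ne n 0 with rfl | hn
      · simp
      · positivity
    have key := ih hq hqh (K := K * (n / (n + 1)) ^ n) (by positivity) fun x hx => by
      have hprod : 0 < ∏ j, x j := Finset.prod_pos fun j _ => hx j
      have h := Polynomial.mul_pow_le_coeff_one_of_real_rooted n
        ((finSuccEquiv ℝ n P).map (eval x)) ?_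
        (fun hn w hw => hs.real_rooted hP hn hx hw) (K * ∏ j, x j) ?_ (by positivity)
      · rw [Polynomial.coeff_map] at h
        linarith
      · refine Polynomial.natDegree_map_le.trans ?_
        rw [natDegree_finSuccEquiv]
        exact (degreeOf_le_totalDegree P 0).trans hP.totalDegree_le
      · intro t ht
        rw [← eval_eq_eval_mv_eval']
        have := hcap (Fin.cons t x) fun j => Fin.cases (by simpa using ht) (by simpa using hx) j
        rw [Fin.prod_univ_succ] at this
        simp only [Fin.cons_zero, Fin.cons_succ] at this
        linarith
    rw [finSuccEquiv_coeff_coeff] at key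
    have hcons : (Finsupp.equivFunOnFinite.symm fun _ => 1 : Fin n →₀ ℕ).cons 1 =
        (Finsupp.equivFunOnFinite.symm fun _ => 1 : Fin (n + 1) →₀ ℕ) := by
      ext j
      refine Fin.cases ?_ (fun j => ?_) j <;> simp
    rw [hcons] at key
    refine le_trans (le_of_eq ?_) key
    rw [Nat.factorial_succ, div_pow, pow_succ]
    rcases eq_or_ne n 0 with rfl | hn
    · simp
    · push_cast
      field_simp

end MvPolynomial

namespace Matrix

open MvPolynomial

/-- The product of the linear forms given by the rows of a matrix. -/
noncomputable def rowProduct {n : ℕ} (A : Matrix (Fin n) (Fin n) ℝ) : MvPolynomial (Fin n) ℝ :=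
  ∏ i, ∑ j, C (A i j) * X j

theorem rowProduct_isHomogeneous {n : ℕ} (A : Matrix (Fin n) (Fin n) ℝ) :
    A.rowProduct.IsHomogeneous n := by
  rw [rowProduct]
  have := IsHomogeneous.prod Finset.univ
    (fun i => ∑ j, C (A i j) * X j : Fin n → MvPolynomial (Fin n) ℝ)
    (fun _ => 1) fun i _ => IsHomogeneous.sum _ _ _ fun j _ => isHomogeneous_C_mul_X _ _
  simpa using this

theorem rowProduct_halfPlaneStable {n : ℕ} {A : Matrix (Fin n) (Fin n) ℝ}
    (hA : ∀ i j, 0 < A i j) : A.rowProduct.HalfPlaneStable := by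
  intro z hz ⟨j, hj⟩
  rw [rowProduct, map_prod, Finset.prod_ne_zero_iff]
  intro i _ h
  have hre := congrArg Complex.re h
  simp only [map_sum, map_mul, aeval_C, aeval_X, Complex.coe_algebraMap, Complex.re_sum,
    Complex.re_ofReal_mul, Complex.zero_re] at hre
  have : 0 < ∑ j, A i j * (z j).re :=
    Finset.sum_pos' (fun j _ => mul_nonneg (hA i j).le (hz j))
      ⟨j, Finset.mem_univ j, mul_pos (hA i j) hj⟩
  exact this.ne' hre

theorem coeff_rowProduct {n : ℕ} (A : Matrix (Fin n) (Fin n) ℝ) :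
    coeff (Finsupp.equivFunOnFinite.symm fun _ => 1) A.rowProduct =
      ∑ σ : Equiv.Perm (Fin n), ∏ i, A i (σ i) := by
  rw [rowProduct, Finset.prod_univ_sum, coeff_sum]
  have hterm : ∀ f : Fin n → Fin n,
      coeff (Finsupp.equivFunOnFinite.symm fun _ => 1) (∏ i, C (A i (f i)) * X (f i)) =
        if Function.Bijective f then ∏ i, A i (f i) else 0 := by
    intro f
    have hmon : (∏ i, C (A i (f i)) * X (f i) : MvPolynomial (Fin n) ℝ) =
        monomial (∑ i, Finsupp.single (f i) 1) (∏ i, A i (f i)) := by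
      rw [monomial_sum_prod]
      simp_rw [C_mul_X_eq_monomial]
    have hiff : (∑ i, Finsupp.single (f i) 1 : Fin n →₀ ℕ) =
        (Finsupp.equivFunOnFinite.symm fun _ => 1) ↔ Function.Bijective f := by
      constructor
      · intro h
        rw [← Finite.surjective_iff_bijective]
        intro j
        have hj := DFunLike.congr_fun h j
        rw [Finsupp.finsetSum_apply] at hj
        obtain ⟨i, -, hi⟩ := Finset.exists_ne_zero_of_sum_ne_zero
          (hj.trans_ne (by simp : (Finsupp.equivFunOnFinite.symm fun _ => 1 : Fin n →₀ ℕ) j ≠ 0))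
        exact ⟨i, by simpa [Finsupp.single_apply] using hi⟩
      · intro h
        rw [h.sum_comp fun j => (Finsupp.single j 1 : Fin n →₀ ℕ)]
        ext j
        simp [Finsupp.finsetSum_apply, Finsupp.single_apply]
    rw [hmon, coeff_monomial]
    simp only [hiff]
  rw [Fintype.piFinset_univ, Finset.sum_congr rfl fun f _ => hterm f, ← Finset.sum_filter]
  exact Finset.sum_bij (fun f hf => Equiv.ofBijective f (Finset.mem_filter.1 hf).2)
    (fun _ _ => Finset.mem_univ _) (fun _ _ _ _ h => by injection h)
    (fun σ _ => ⟨σ, Finset.mem_filter.2 ⟨Finset.mem_univ _, σ.bijective⟩,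
      Equiv.coe_fn_injective rfl⟩)
    fun _ _ => rfl

theorem prod_le_eval_rowProduct {n : ℕ} {A : Matrix (Fin n) (Fin n) ℝ}
    (hA : A ∈ doublyStochastic ℝ (Fin n)) {x : Fin n → ℝ} (hx : ∀ j, 0 < x j) :
    ∏ j, x j ≤ eval x A.rowProduct := by
  have hA' := mem_doublyStochastic_iff_sum.1 hA
  have hrow : ∀ i, ∏ j, x j ^ A i j ≤ ∑ j, A i j * x j := fun i =>
    Real.geom_mean_le_arith_mean_weighted _ _ _ (fun j _ => hA'.1 i j) (hA'.2.1 i)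
      fun j _ => (hx j).le
  calc ∏ j, x j = ∏ i, ∏ j, x j ^ A i j := by
        rw [Finset.prod_comm]
        refine Finset.prod_congr rfl fun j _ => ?_
        rw [← Real.rpow_sum_of_pos (hx j), hA'.2.2 j, Real.rpow_one]
    _ ≤ ∏ i, ∑ j, A i j * x j :=
        Finset.prod_le_prod (fun i _ => Finset.prod_nonneg fun j _ => Real.rpow_nonneg (hx j).le _)
          fun i _ => hrow i
    _ = _ := by simp [rowProduct]

theorem van_der_waerden_of_pos {n : ℕ} {A : Matrix (Fin n) (Fin n) ℝ}
    (hA : A ∈ doublyStochastic ℝ (Fin n)) (hpos : ∀ i j, 0 < A i j) :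
    (n.factorial / (n : ℝ) ^ n) ≤ ∑ σ : Equiv.Perm (Fin n), ∏ i, A i (σ i) := by
  rw [← coeff_rowProduct, ← one_mul (_ / _)]
  refine (rowProduct_halfPlaneStable hpos).capacity_mul_le_coeff A.rowProduct_isHomogeneous
    one_pos fun x hx => ?_
  rw [one_mul]
  exact prod_le_eval_rowProduct hA hx

/-- The van der Waerden bound (Egorychev, Falikman) for the permanent of a doubly stochastic
matrix. -/
theorem van_der_waerden {n : ℕ} {A : Matrix (Fin n) (Fin n) ℝ}
    (hA : A ∈ doublyStochastic ℝ (Fin n)) :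
    (n.factorial / (n : ℝ) ^ n) ≤ ∑ σ : Equiv.Perm (Fin n), ∏ i, A i (σ i) := by
  rcases eq_or_ne n 0 with rfl | hn
  · simp
  have hn0 : (0 : ℝ) < n := by positivity
  have hA' := mem_doublyStochastic_iff_sum.1 hA
  set F : ℝ → ℝ := fun ε => ∑ σ : Equiv.Perm (Fin n), ∏ i, ((1 - ε) * A i (σ i) + ε * (1 / n))
    with hF
  have hcont : Continuous F := by fun_prop
  have ht : Filter.Tendsto F (nhdsWithin 0 (Set.Ioi 0)) (nhds (F 0)) :=
    hcont.continuousWithinAt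
  have hF0 : F 0 = ∑ σ : Equiv.Perm (Fin n), ∏ i, A i (σ i) := by simp [hF]
  rw [← hF0]
  refine ge_of_tendsto ht ?_
  filter_upwards [Ioo_mem_nhdsGT (one_pos : (0 : ℝ) < 1)] with ε hε
  have hB : ∀ i j, 0 < (1 - ε) * A i j + ε * (1 / n) := fun i j =>
    add_pos_of_nonneg_of_pos (mul_nonneg (by linarith [hε.2]) (hA'.1 i j))
      (mul_pos hε.1 (by positivity))
  refine van_der_waerden_of_pos (A := Matrix.of fun i j => (1 - ε) * A i j + ε * (1 / n)) ?_ hB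
  refine mem_doublyStochastic_iff_sum.2 ⟨fun i j => (hB i j).le, fun i => ?_, fun j => ?_⟩
  · simp only [Matrix.of_apply]
    rw [Finset.sum_add_distrib, ← Finset.mul_sum, hA'.2.1 i]
    simp
    field_simp
    ring
  · simp only [Matrix.of_apply]
    rw [Finset.sum_add_distrib, ← Finset.mul_sum, hA'.2.2 j]
    simp
    field_simp
    ring

end Matrix

/-- Let `Q` be a 2-regular bipartite graph with parts `X` and `Z`, each of size `m ≥ 3`
(encoded by the adjacency relation `A : Fin m → Fin m → Prop` between the parts, in which
every row and every column has exactly two entries).  The number of perfect matchings of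
the bipartite complement of `Q`, i.e. bijections `σ : X → Z` with `x σ(x) ∉ E(Q)` for all
`x`, is at least `(m!/m^m)·(m-2)^m`. -/
theorem matchings_of_complement_of_two_regular (m : ℕ) (hm : 3 ≤ m)
    (A : Fin m → Fin m → Prop)
    (hrow : ∀ x : Fin m, (Finset.univ.filter (fun z => A x z)).card = 2)
    (hcol : ∀ z : Fin m, (Finset.univ.filter (fun x => A x z)).card = 2) :
    (((Finset.univ : Finset (Equiv.Perm (Fin m))).filter
        (fun σ => ∀ x : Fin m, ¬ A x (σ x))).card : ℝ) ≥
      ((Nat.factorial m : ℝ) / (m : ℝ) ^ m) * ((m : ℝ) - 2) ^ m := by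
  have hm2 : (0 : ℝ) < (m : ℝ) - 2 := by
    have : (3 : ℝ) ≤ m := by exact_mod_cast hm
    linarith
  have hcount : ∀ p : Fin m → Prop, (Finset.univ.filter p).card = 2 →
      ∑ z, (if p z then (0 : ℝ) else 1 / ((m : ℝ) - 2)) = 1 := by
    intro p hp
    have hsplit := Finset.card_filter_add_card_filter_not (s := Finset.univ) p
    rw [hp, Finset.card_univ, Fintype.card_fin] at hsplit
    have hcast : ((Finset.univ.filter fun z => ¬ p z).card : ℝ) = (m : ℝ) - 2 := by
      rw [eq_sub_iff_add_eq', ← Nat.cast_ofNat (R := ℝ), ← Nat.cast_add]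
      exact congrArg Nat.cast hsplit
    rw [Finset.sum_ite, Finset.sum_const_zero, zero_add, Finset.sum_const, nsmul_eq_mul, hcast]
    field_simp
  have hB : (Matrix.of fun x z => if A x z then (0 : ℝ) else 1 / ((m : ℝ) - 2)) ∈
      doublyStochastic ℝ (Fin m) := by
    refine mem_doublyStochastic_iff_sum.2 ⟨fun x z => ?_, fun x => hcount _ (hrow x),
      fun z => hcount _ (hcol z)⟩
    simp only [Matrix.of_apply]
    split_ifs <;> positivity
  have hvdw := Matrix.van_der_waerden hB
  have hterm : ∀ σ : Equiv.Perm (Fin m),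
      ∏ x, (if A x (σ x) then (0 : ℝ) else 1 / ((m : ℝ) - 2)) =
        if ∀ x, ¬ A x (σ x) then (1 / ((m : ℝ) - 2)) ^ m else 0 := by
    intro σ
    split_ifs with h
    · simp [h]
    · push Not at h
      obtain ⟨x, hx⟩ := h
      exact Finset.prod_eq_zero (Finset.mem_univ x) (if_pos hx)
  simp only [Matrix.of_apply] at hvdw
  rw [Finset.sum_congr rfl fun σ _ => hterm σ, ← Finset.sum_filter, Finset.sum_const,
    nsmul_eq_mul, one_div, inv_pow, ← div_eq_mul_inv, le_div_iff₀ (by positivity)] at hvdw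
  exact hvdw
end

section
/- Fix reals 0 < δ < β < 1 and integers k ≥ 1, r ≥ 3. For all sufficiently large n there exists an (n, r, k, β, δ)-packing of K_n^r. -/
open Finset

/-- An element of a packing: an `r`-subgraph of `K_n^r`, given by its vertex set and its
edge set. -/
abbrev Subgraph (n : ℕ) := Finset (Fin n) × Finset (Finset (Fin n))

/-- An `(n, r, k, β, δ)`-packing of `K_n^r`: a set `L` of pairwise edge-disjoint
`r`-subgraphs of `K_n^r` such that (i) every element has `q = ⌈n^β⌉` vertices; (ii) every
vertex set `X` with `1 ≤ |X| ≤ r-1` inside an element `B` has degree at least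
`n^{-δ}·C(q-|X|, r-|X|)` in `B`; (iii) at most half the edges of `K_n^r` lie in elements
of `L`; (iv) `|L| ≥ n^{r-rβ}` and `k ∣ |L|`; (v) all elements have the same number of
edges. -/
def IsPacking (n r k : ℕ) (β δ : ℝ) (L : Finset (Subgraph n)) : Prop :=
  (∀ B ∈ L, B.1.card = ⌈(n : ℝ) ^ β⌉₊ ∧ ∀ e ∈ B.2, e ⊆ B.1 ∧ e.card = r) ∧
  (∀ B ∈ L, ∀ B' ∈ L, B ≠ B' → Disjoint B.2 B'.2) ∧
  (∀ B ∈ L, ∀ X ⊆ B.1, 1 ≤ X.card → X.card ≤ r - 1 →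
    (n : ℝ) ^ (-δ) * ((⌈(n : ℝ) ^ β⌉₊ - X.card).choose (r - X.card) : ℝ) ≤
      ((B.2.filter (fun e => X ⊆ e)).card : ℝ)) ∧
  (2 * ∑ B ∈ L, B.2.card ≤ n.choose r) ∧
  ((n : ℝ) ^ ((r : ℝ) - r * β) ≤ (L.card : ℝ) ∧ k ∣ L.card) ∧
  (∀ B ∈ L, ∀ B' ∈ L, B.2.card = B'.2.card)

/-- A union bound in first-moment form: if the nonnegative functions `F j` have means summing to
less than `1`, then some point makes all of them less than `1`. -/
theorem exists_forall_lt_one_of_sum_le {Ω J : Type*} [Fintype Ω] (s : Finset J)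
    (F : J → Ω → ℝ) (hF : ∀ j ω, 0 ≤ F j ω) (ε : ℝ)
    (hsum : ∀ j ∈ s, ∑ ω, F j ω ≤ ε * Fintype.card Ω) (hε : #s * ε < 1) [Nonempty Ω] :
    ∃ ω, ∀ j ∈ s, F j ω < 1 := by
  by_contra! h
  have hle : (Fintype.card Ω : ℝ) ≤ ∑ ω, ∑ j ∈ s, F j ω := by
    rw [← nsmul_one, ← Finset.card_univ, ← Finset.sum_const]
    refine Finset.sum_le_sum fun ω _ => ?_
    obtain ⟨j, hj, hj1⟩ := h ω
    exact hj1.trans (Finset.single_le_sum (f := fun j => F j ω) (fun i _ => hF i ω) hj)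
  rw [Finset.sum_comm] at hle
  have hub := Finset.sum_le_sum hsum
  rw [Finset.sum_const, nsmul_eq_mul] at hub
  have hpos : (0 : ℝ) < Fintype.card Ω := by exact_mod_cast Fintype.card_pos
  nlinarith

/-- Random `q`-subsets `B i` cover each `r`-set only few times. -/
theorem exists_blocks {n r q m C : ℕ} (hrq : r ≤ q) (hqn : q ≤ n)
    (h : (n.choose r : ℝ) * (1 + (q.choose r : ℝ) / n.choose r) ^ m < 2 ^ C) :
    ∃ B : Fin m → Finset (Fin n), (∀ i, #(B i) = q) ∧
      ∀ e : Finset (Fin n), #e = r → #{i | e ⊆ B i} ≤ C := by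
  classical
  set S := powersetCard q (univ : Finset (Fin n)) with hS
  have hScard : #S = n.choose q := by simp [hS]
  have hnr : (0 : ℝ) < n.choose r := by exact_mod_cast Nat.choose_pos (hrq.trans hqn)
  have : Nonempty S := by
    obtain ⟨s, hs⟩ : S.Nonempty := powersetCard_nonempty.2 (by simpa using hqn)
    exact ⟨⟨s, hs⟩⟩
  have h2C : (0 : ℝ) < 2 ^ C := by positivity
  obtain ⟨f, hf⟩ := exists_forall_lt_one_of_sum_le (Ω := Fin m → S)
    (powersetCard r (univ : Finset (Fin n)))
    (fun e f => (∏ i, if e ⊆ (f i : Finset (Fin n)) then (2 : ℝ) else 1) / 2 ^ C)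
    (fun e f => div_nonneg (prod_nonneg fun i _ => by split_ifs <;> norm_num) h2C.le)
    ((1 + (q.choose r : ℝ) / n.choose r) ^ m / 2 ^ C)
    (fun e he => by
      rw [mem_powersetCard] at he
      rw [← sum_div, ← Fintype.sum_pow
        (fun s : S => if e ⊆ (s : Finset (Fin n)) then (2 : ℝ) else 1) m]
      have hone : ∑ s : S, (if e ⊆ (s : Finset (Fin n)) then (2 : ℝ) else 1)
          = n.choose q * (1 + (q.choose r : ℝ) / n.choose r) := by
        rw [Finset.sum_coe_sort S (fun s => if e ⊆ s then (2 : ℝ) else 1)]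
        have : ∀ s ∈ S, (if e ⊆ s then (2 : ℝ) else 1) = 1 + if e ⊆ s then 1 else 0 := by
          intro s _; split_ifs <;> norm_num
        rw [sum_congr rfl this, sum_add_distrib, ← Finset.sum_filter, sum_const, sum_const,
          card_filter_powersetCard_subset _ _ _ (subset_univ _) (he.2.trans_le hrq), hScard,
          he.2, Finset.card_univ, Fintype.card_fin]
        have := Nat.choose_mul (n := n) hrq
        have : (n.choose q : ℝ) * q.choose r = n.choose r * (n - r).choose (q - r) := by
          exact_mod_cast this
        simp only [nsmul_eq_mul, mul_one]
        field_simp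
        linarith
      rw [hone, mul_pow]
      simp only [Fintype.card_pi, Fintype.card_coe, hScard, prod_const, Finset.card_univ,
        Fintype.card_fin]
      push_cast
      exact le_of_eq (by ring))
    (by
      rw [card_powersetCard, Finset.card_univ, Fintype.card_fin, ← mul_div_assoc, div_lt_one h2C]
      exact h)
  refine ⟨fun i => f i, fun i => (mem_powersetCard.1 (f i).2).2, fun e he => ?_⟩
  have := hf e (mem_powersetCard.2 ⟨subset_univ _, he⟩)
  rw [div_lt_one h2C, ← prod_filter, prod_const] at this
  exact ((pow_lt_pow_iff_right₀ (by norm_num : (1 : ℝ) < 2)).1 this).le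

/-- If every `(d + 1)`-set lies in at most `C` of the blocks `B i`, a random distribution of the
sets among the blocks containing them leaves every `d`-subset of a block with large degree. -/
theorem exists_assignment {n d q m C s : ℕ} (hC : 0 < C) (B : Fin m → Finset (Fin n))
    (hB : ∀ i, #(B i) = q) (hcov : ∀ e : Finset (Fin n), #e = d + 1 → #{i | e ⊆ B i} ≤ C)
    (h : (m : ℝ) * n.choose d * (2 ^ s * Real.exp (-((q - d : ℕ) / (2 * C)))) < 1) :
    ∃ E : Fin m → Finset (Finset (Fin n)), (∀ i, E i ⊆ powersetCard (d + 1) (B i)) ∧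
      (∀ i j, i ≠ j → Disjoint (E i) (E j)) ∧
      ∀ i, ∀ X ⊆ B i, #X = d → s ≤ #{e ∈ E i | X ⊆ e} := by
  classical
  have : Nonempty (Fin C) := ⟨⟨0, hC⟩⟩
  have hC' : (0 : ℝ) < C := by exact_mod_cast hC
  have hρ : ∀ e : Finset (Fin n), ∃ ρ : Fin m → Fin C,
      #e = d + 1 → Set.InjOn ρ {i | e ⊆ B i} := by
    intro e
    by_cases he : #e = d + 1
    · obtain ⟨ρ⟩ := Function.Embedding.nonempty_of_card_le (α := {i // e ⊆ B i}) (β := Fin C)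
        (by simpa [Fintype.card_subtype] using hcov e he)
      refine ⟨fun i => if hi : e ⊆ B i then ρ ⟨i, hi⟩ else ⟨0, hC⟩, fun _ i hi j hj hij => ?_⟩
      rw [Set.mem_ofPred_eq] at hi hj
      simp only [dif_pos hi, dif_pos hj] at hij
      exact congrArg Subtype.val (ρ.injective hij)
    · exact ⟨fun _ => ⟨0, hC⟩, fun h => absurd h he⟩
  choose ρ hρ using hρ
  let N : Fin m × Finset (Fin n) → Finset (Finset (Fin n)) :=
    fun p => (B p.1 \ p.2).image (insert · p.2)
  obtain ⟨χ, hχ⟩ := exists_forall_lt_one_of_sum_le (Ω := Finset (Fin n) → Fin C)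
    ((univ : Finset (Fin m)) ×ˢ powersetCard d (univ : Finset (Fin n)))
    (fun p χ => 2 ^ s * ∏ e, if e ∈ N p ∧ χ e = ρ e p.1 then (1 / 2 : ℝ) else 1)
    (fun p χ => mul_nonneg (by positivity)
      (prod_nonneg fun i _ => by split_ifs <;> norm_num))
    (2 ^ s * Real.exp (-((q - d : ℕ) / (2 * C))))
    (fun p hp => by
      have hpd : #p.2 = d := (mem_powersetCard.1 (mem_product.1 hp).2).2
      rw [← mul_sum, ← Fintype.prod_sum
        (fun e c => if e ∈ N p ∧ c = ρ e p.1 then (1 / 2 : ℝ) else 1), mul_assoc]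
      refine mul_le_mul_of_nonneg_left ?_ (by positivity)
      have hNcard : q - d ≤ #(N p) := by
        rw [card_image_of_injOn, ← hB p.1, ← hpd]
        · exact le_card_sdiff _ _
        · intro x hx y hy hxy
          have hx' : x ∉ p.2 := (mem_sdiff.1 hx).2
          have : x ∈ insert y p.2 := by
            rw [← show insert x p.2 = insert y p.2 from hxy]
            exact mem_insert_self x p.2
          exact (mem_insert.1 this).resolve_right hx'
      have hterm : ∀ e : Finset (Fin n),
          ∑ c : Fin C, (if e ∈ N p ∧ c = ρ e p.1 then (1 / 2 : ℝ) else 1)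
            ≤ C * if e ∈ N p then Real.exp (-(1 / (2 * C))) else 1 := by
        intro e
        by_cases he : e ∈ N p
        · have h1 : ∀ c : Fin C, (if e ∈ N p ∧ c = ρ e p.1 then (1 / 2 : ℝ) else 1)
              = 1 - if c = ρ e p.1 then 1 / 2 else 0 := by
            intro c; by_cases hc : c = ρ e p.1 <;> simp [he, hc]; norm_num
          simp only [h1, sum_sub_distrib, sum_ite_eq', mem_univ, if_true, if_pos he]
          have h2 := Real.add_one_le_exp (-(1 / (2 * C : ℝ)))
          have h3 : (C : ℝ) * (-(1 / (2 * C : ℝ)) + 1) = C - 1 / 2 := by field_simp; ring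
          have h4 := mul_le_mul_of_nonneg_left h2 hC'.le
          rw [h3] at h4
          simpa only [sum_const, Finset.card_univ, Fintype.card_fin, nsmul_eq_mul, mul_one]
            using h4
        · simp [he]
      refine (prod_le_prod (fun e _ => sum_nonneg fun c _ => by split_ifs <;> norm_num)
        fun e _ => hterm e).trans ?_
      rw [prod_mul_distrib, ← prod_filter, prod_const, prod_const, mul_comm]
      simp only [filter_mem_eq_inter, univ_inter, Fintype.card_pi, prod_const, Fintype.card_fin,
        Finset.card_univ, Nat.cast_pow]
      refine mul_le_mul_of_nonneg_right ?_ (by positivity)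
      rw [← Real.exp_nat_mul]
      refine Real.exp_le_exp.2 ?_
      have h5 : ((q - d : ℕ) : ℝ) ≤ #(N p) := by exact_mod_cast hNcard
      have h6 : (0 : ℝ) ≤ 1 / (2 * C) := by positivity
      have h7 := mul_le_mul_of_nonneg_right h5 h6
      rw [mul_neg, neg_le_neg_iff, div_eq_mul_one_div]
      exact h7)
    (by simpa [card_product] using h)
  refine ⟨fun i => {e ∈ powersetCard (d + 1) (B i) | χ e = ρ e i}, fun i => filter_subset _ _,
    fun i j hij => ?_, fun i X hX hXd => ?_⟩
  · rw [disjoint_left]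
    intro e hei hej
    simp only [mem_filter, mem_powersetCard] at hei hej
    exact hij (hρ e hei.1.2 hei.1.1 hej.1.1 (hei.2.symm.trans hej.2))
  · have := hχ (i, X) (by simp [hXd])
    rw [← prod_filter, prod_const, one_div, inv_pow, mul_inv_lt_iff₀ (by positivity),
      one_mul] at this
    have hlt := (pow_lt_pow_iff_right₀ (by norm_num : (1 : ℝ) < 2)).1 this
    refine hlt.le.trans (card_le_card fun e he => ?_)
    simp only [N, mem_filter, mem_univ, true_and, mem_image, mem_sdiff] at he
    obtain ⟨⟨x, ⟨hxB, hxX⟩, rfl⟩, hc⟩ := he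
    simp only [mem_filter, mem_powersetCard]
    exact ⟨⟨⟨insert_subset hxB hX, by rw [card_insert_of_notMem hxX, hXd]⟩, hc⟩,
      subset_insert _ _⟩

/-- Degrees of small sets are controlled by degrees of `d`-sets. -/
theorem choose_mul_le_degree_mul {α : Type*} [DecidableEq α] {d s : ℕ} {V : Finset α}
    {H : Finset (Finset α)} (hH : H ⊆ powersetCard (d + 1) V)
    (hdeg : ∀ Y ⊆ V, #Y = d → s ≤ #{e ∈ H | Y ⊆ e}) {X : Finset α} (hX : X ⊆ V) (hXd : #X ≤ d) :
    (#V - #X).choose (d - #X) * s ≤ #{e ∈ H | X ⊆ e} * (d + 1 - #X) := by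
  have := card_nsmul_le_card_nsmul (R := ℕ) (s := {Y ∈ powersetCard d V | X ⊆ Y})
    (t := {e ∈ H | X ⊆ e}) (fun Y e => Y ⊆ e) (m := s) (n := d + 1 - #X) ?_ ?_
  · simpa [card_filter_powersetCard_subset X V d hX hXd] using this
  · intro Y hY
    simp only [mem_filter, mem_powersetCard] at hY
    refine (hdeg Y hY.1.1 hY.1.2).trans (card_le_card fun e he => ?_)
    simp only [mem_filter, mem_bipartiteAbove] at he ⊢
    exact ⟨⟨he.1, hY.2.trans he.2⟩, he.2⟩
  · intro e he
    rw [mem_filter] at he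
    have heV := mem_powersetCard.1 (hH he.1)
    have hcount := card_filter_powersetCard_subset X e d he.2 hXd
    have hch : (d + 1 - #X).choose (d - #X) = d + 1 - #X := by
      rw [Nat.succ_sub hXd, Nat.succ_eq_add_one, Nat.choose_succ_self_right]
    rw [heV.2, hch] at hcount
    rw [Nat.cast_id, ← hcount]
    refine card_le_card fun Y hY => ?_
    simp only [mem_bipartiteBelow, mem_filter, mem_powersetCard] at hY ⊢
    exact ⟨⟨hY.2, hY.1.1.2⟩, hY.1.2⟩

/-- A uniform hypergraph of minimum `d`-degree `(d + 1) * t` has a subgraph of minimum `d`-degree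
`t` with a prescribed number of edges. -/
theorem exists_trimmed {α : Type*} [DecidableEq α] {d t : ℕ} {V : Finset α}
    {E : Finset (Finset α)} (hE : E ⊆ powersetCard (d + 1) V)
    (hdeg : ∀ Y ⊆ V, #Y = d → (d + 1) * t ≤ #{e ∈ E | Y ⊆ e}) :
    ∃ H ⊆ E, #H = (#V).choose d * t ∧ ∀ Y ⊆ V, #Y = d → t ≤ #{e ∈ H | Y ⊆ e} := by
  have hD : ∀ Y : Finset α, ∃ D ⊆ E, Y ⊆ V → #Y = d → #D = t ∧ ∀ e ∈ D, Y ⊆ e := by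
    intro Y
    by_cases hY : Y ⊆ V ∧ #Y = d
    · obtain ⟨D, hDs, hDc⟩ := exists_subset_card_eq
        ((Nat.le_mul_of_pos_left t d.succ_pos).trans (hdeg Y hY.1 hY.2))
      exact ⟨D, hDs.trans (filter_subset _ _), fun _ _ =>
        ⟨hDc, fun e he => (mem_filter.1 (hDs he)).2⟩⟩
    · exact ⟨∅, empty_subset _, fun h1 h2 => absurd ⟨h1, h2⟩ hY⟩
  choose D hDE hD using hD
  have hlow := choose_mul_le_degree_mul hE hdeg (empty_subset V) (by simp)
  have hlow' : (#V).choose d * t ≤ #E := by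
    simp only [card_empty, Nat.sub_zero, empty_subset, filter_true] at hlow
    refine Nat.le_of_mul_le_mul_right (c := d + 1) ?_ d.succ_pos
    linarith
  obtain ⟨H, hSH, hHE, hHc⟩ := exists_subsuperset_card_eq
    (s := (powersetCard d V).biUnion D) (t := E) (n := (#V).choose d * t)
    (biUnion_subset.2 fun Y _ => hDE Y)
    (by
      refine (card_biUnion_le_card_mul _ _ t fun Y hY => ?_).trans_eq (by rw [card_powersetCard])
      have hY := mem_powersetCard.1 hY
      exact (hD Y hY.1 hY.2).1.le) hlow'
  refine ⟨H, hHE, hHc, fun Y hY hYd => ?_⟩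
  obtain ⟨h1, h2⟩ := hD Y hY hYd
  rw [← h1]
  refine card_le_card fun e he => mem_filter.2 ⟨hSH ?_, h2 e he⟩
  exact mem_biUnion.2 ⟨Y, mem_powersetCard.2 ⟨hY, hYd⟩, he⟩

/-- The packing, given numerical parameters satisfying the inequalities needed. -/
theorem exists_packing_of_parameters {n d k q m C t : ℕ} {β δ : ℝ} (hq : q = ⌈(n : ℝ) ^ β⌉₊)
    (hdq : d + 1 ≤ q) (hqn : q ≤ n) (hC : 0 < C) (ht : 0 < t) (hkm : k ∣ m)
    (htq : (n : ℝ) ^ (-δ) * q ≤ t)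
    (hm : (n : ℝ) ^ (((d + 1 : ℕ) : ℝ) - (d + 1 : ℕ) * β) ≤ m)
    (hcov : (n.choose (d + 1) : ℝ) * (1 + (q.choose (d + 1) : ℝ) / n.choose (d + 1)) ^ m < 2 ^ C)
    (hassign : (m : ℝ) * n.choose d *
      (2 ^ ((d + 1) * t) * Real.exp (-((q - d : ℕ) / (2 * C)))) < 1)
    (hhalf : 2 * (m * (q.choose d * t)) ≤ n.choose (d + 1)) :
    ∃ L : Finset (Subgraph n), IsPacking n (d + 1) k β δ L := by
  classical
  obtain ⟨B, hB, hBC⟩ := exists_blocks hdq hqn hcov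
  obtain ⟨E, hEB, hEd, hEdeg⟩ := exists_assignment hC B hB hBC hassign
  choose H hHE hHc hHdeg using fun i => exists_trimmed (hEB i) (hEdeg i)
  simp only [hB] at hHc
  have hHB : ∀ i, H i ⊆ powersetCard (d + 1) (B i) := fun i => (hHE i).trans (hEB i)
  have hHd : ∀ i j, i ≠ j → Disjoint (H i) (H j) := fun i j hij =>
    disjoint_of_subset_left (hHE i) (disjoint_of_subset_right (hHE j) (hEd i j hij))
  have hinj : Function.Injective fun i => ((B i, H i) : Subgraph n) := by
    intro i j hij
    by_contra hne
    have h1 := hHd i j hne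
    rw [show H j = H i from (Prod.ext_iff.1 hij).2.symm, disjoint_self_iff_empty] at h1
    have h2 := hHc i
    simp only [h1, card_empty] at h2
    have := Nat.mul_pos (Nat.choose_pos (n := q) (k := d) (by omega)) ht
    omega
  refine ⟨univ.image fun i => (B i, H i), ?_, ?_, ?_, ?_, ?_, ?_⟩
  · simp only [mem_image, mem_univ, true_and, forall_exists_index, forall_apply_eq_imp_iff]
    exact fun i => ⟨(hB i).trans hq, fun e he => mem_powersetCard.1 (hHB i he)⟩
  · simp only [mem_image, mem_univ, true_and, forall_exists_index, forall_apply_eq_imp_iff]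
    exact fun i j hij => hHd i j fun h => hij (by rw [h])
  · simp only [mem_image, mem_univ, true_and, forall_exists_index, forall_apply_eq_imp_iff]
    intro i X hX _ hXd
    rw [Nat.add_sub_cancel] at hXd
    rw [← hq]
    have hdeg := choose_mul_le_degree_mul (hHB i) (hHdeg i) hX hXd
    have hid := Nat.choose_succ_right_eq (q - #X) (d - #X)
    rw [← Nat.succ_eq_add_one, ← Nat.succ_sub hXd, Nat.succ_eq_add_one,
      show q - #X - (d - #X) = q - d by omega] at hid
    rw [hB i] at hdeg
    have hpos : (0 : ℝ) < (d + 1 - #X : ℕ) := by exact_mod_cast (by omega)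
    have hdeg' : ((q - #X).choose (d - #X) : ℝ) * t
        ≤ #{e ∈ H i | X ⊆ e} * (d + 1 - #X : ℕ) := by exact_mod_cast hdeg
    have hid' : ((q - #X).choose (d + 1 - #X) : ℝ) * (d + 1 - #X : ℕ)
        = (q - #X).choose (d - #X) * (q - d : ℕ) := by exact_mod_cast hid
    refine le_of_mul_le_mul_right ?_ hpos
    refine le_trans ?_ hdeg'
    rw [mul_assoc, hid']
    have hqd : (n : ℝ) ^ (-δ) * (q - d : ℕ) ≤ t := by
      refine le_trans (mul_le_mul_of_nonneg_left ?_ (by positivity)) htq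
      exact_mod_cast Nat.sub_le q d
    have := mul_le_mul_of_nonneg_left hqd (Nat.cast_nonneg ((q - #X).choose (d - #X)) : (0 : ℝ) ≤ _)
    linarith
  · rw [sum_image hinj.injOn]
    simpa [hHc] using hhalf
  · rw [card_image_of_injective _ hinj, Finset.card_univ, Fintype.card_fin]
    exact ⟨hm, hkm⟩
  · simp only [mem_image, mem_univ, true_and, forall_exists_index, forall_apply_eq_imp_iff]
    exact fun i j => (hHc i).trans (hHc j).symm

theorem eventually_add_mul_log_lt_rpow (A b : ℝ) {a : ℝ} (ha : 0 < a) :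
    ∀ᶠ n : ℕ in Filter.atTop, A + b * Real.log n < (n : ℝ) ^ a := by
  have h1 : (fun x : ℝ => A + b * Real.log x) =o[Filter.atTop] fun x => x ^ a := by
    refine Asymptotics.IsLittleO.add ?_ ((isLittleO_log_rpow_atTop ha).const_mul_left b)
    exact Asymptotics.isLittleO_const_left.2
      (Or.inr (Filter.tendsto_abs_atTop_atTop.comp (tendsto_rpow_atTop ha)))
  have h2 := h1.bound (by norm_num : (0 : ℝ) < 1 / 2)
  have h3 : ∀ᶠ x : ℝ in Filter.atTop, A + b * Real.log x < x ^ a := by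
    filter_upwards [h2, Filter.eventually_gt_atTop 0] with x hx hx0
    have hpos := Real.rpow_pos_of_pos hx0 a
    rw [Real.norm_eq_abs, Real.norm_eq_abs, abs_of_pos hpos] at hx
    linarith [le_abs_self (A + b * Real.log x)]
  exact tendsto_natCast_atTop_atTop.eventually h3

theorem natCeil_le_two_mul {y : ℝ} (hy : 1 ≤ y) : (⌈y⌉₊ : ℝ) ≤ 2 * y := by
  linarith [Nat.ceil_lt_add_one (zero_le_one.trans hy)]

theorem div_two_pow_div_factorial_le_choose {n r : ℕ} (h : 2 * r ≤ n) :
    ((n : ℝ) / 2) ^ r / r.factorial ≤ n.choose r := by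
  refine le_trans ?_ (Nat.pow_le_choose r n)
  gcongr
  rw [Nat.cast_sub (by omega)]
  have : (2 * r : ℝ) ≤ n := by exact_mod_cast h
  push_cast
  linarith

theorem choose_div_choose_le {n q r : ℕ} (h : 2 * r ≤ n) (hn : 0 < n) :
    (q.choose r : ℝ) / n.choose r ≤ (q / (n / 2)) ^ r := by
  have hn' : (0 : ℝ) < n := by exact_mod_cast hn
  have h1 := div_two_pow_div_factorial_le_choose h
  have h2 : (q.choose r : ℝ) ≤ (q : ℝ) ^ r / r.factorial := Nat.choose_le_pow_div r q
  calc (q.choose r : ℝ) / n.choose r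
      ≤ ((q : ℝ) ^ r / r.factorial) / (((n : ℝ) / 2) ^ r / r.factorial) := by gcongr
    _ = (q / (n / 2)) ^ r := by
      rw [div_div_div_cancel_right₀ (by positivity), div_pow _ ((n : ℝ) / 2)]

/-- For fixed `0 < δ < β < 1`, `k ≥ 1` and `r ≥ 3`, an `(n, r, k, β, δ)`-packing of
`K_n^r` exists for all sufficiently large `n`. -/
theorem packing_exists (β δ : ℝ) (hδ : 0 < δ) (hδβ : δ < β) (hβ : β < 1)
    (k r : ℕ) (hk : 1 ≤ k) (hr : 3 ≤ r) :
    ∃ N : ℕ, ∀ n : ℕ, N ≤ n → ∃ L : Finset (Subgraph n), IsPacking n r k β δ L := by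
  obtain ⟨d, rfl⟩ : ∃ d, r = d + 1 := ⟨r - 1, by omega⟩
  have hβ0 : 0 < β := hδ.trans hδβ
  have hk0 : (0 : ℝ) < k := by exact_mod_cast hk
  have hlog2 : 0 < Real.log 2 := Real.log_pos (by norm_num)
  set K : ℝ := 2 * k * 4 ^ (d + 1) with hK
  rw [← Filter.eventually_atTop]
  filter_upwards [Filter.eventually_ge_atTop (2 * (d + 1)),
    eventually_add_mul_log_lt_rpow (2 * (d + 1)) 0 hβ0,
    eventually_add_mul_log_lt_rpow 2 0 (sub_pos.2 hβ),
    eventually_add_mul_log_lt_rpow (K / Real.log 2) ((d + 1) / Real.log 2) (half_pos hδ),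
    eventually_add_mul_log_lt_rpow (48 * (d + 1) * Real.log 2) 0 (half_pos hδ),
    eventually_add_mul_log_lt_rpow (16 * Real.log (2 * k)) (32 * (d + 1))
      (by linarith : 0 < β - δ / 2),
    eventually_add_mul_log_lt_rpow (12 * k * 2 ^ d * 2 ^ (d + 1) * (d + 1).factorial) 0 hδ]
    with n hn hnβ hn1β hcov hs hexp hhalf
  simp only [zero_mul, add_zero] at hnβ hn1β hs hhalf
  have hn0 : 0 < n := by omega
  set x : ℝ := (n : ℝ) with hx
  have hx1 : 1 ≤ x := by rw [hx]; exact_mod_cast hn0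
  have hx0 : 0 < x := by linarith
  set q := ⌈x ^ β⌉₊ with hq
  set C := ⌈x ^ (δ / 2)⌉₊ with hC
  set t := ⌈x ^ (-δ) * q⌉₊ with ht
  set m := k * ⌈x ^ (((d + 1 : ℕ) : ℝ) - (d + 1 : ℕ) * β)⌉₊ with hm
  have hq_ge : x ^ β ≤ q := Nat.le_ceil _
  have hq_le : (q : ℝ) ≤ 2 * x ^ β := natCeil_le_two_mul (Real.one_le_rpow hx1 hβ0.le)
  have hC_ge : x ^ (δ / 2) ≤ C := Nat.le_ceil _
  have hC_le : (C : ℝ) ≤ 2 * x ^ (δ / 2) :=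
    natCeil_le_two_mul (Real.one_le_rpow hx1 (half_pos hδ).le)
  have hm_ge : x ^ (((d + 1 : ℕ) : ℝ) - (d + 1 : ℕ) * β) ≤ m := by
    refine (Nat.le_ceil _).trans ?_
    exact_mod_cast Nat.le_mul_of_pos_left _ hk
  have hexp0 : (0 : ℝ) ≤ ((d + 1 : ℕ) : ℝ) - (d + 1 : ℕ) * β := by
    have : (0 : ℝ) < (d + 1 : ℕ) := by positivity
    nlinarith
  have hm_le : (m : ℝ) ≤ 2 * k * x ^ (((d + 1 : ℕ) : ℝ) - (d + 1 : ℕ) * β) := by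
    rw [hm, Nat.cast_mul]
    have := mul_le_mul_of_nonneg_left
      (natCeil_le_two_mul (Real.one_le_rpow hx1 hexp0)) hk0.le
    linarith
  have ht_le : (t : ℝ) ≤ 3 * x ^ (β - δ) := by
    have h1 := (Nat.ceil_lt_add_one (by positivity : 0 ≤ x ^ (-δ) * q)).le
    have h2 : x ^ (-δ) * q ≤ x ^ (-δ) * (2 * x ^ β) := by gcongr
    have h3 : x ^ (-δ) * (2 * x ^ β) = 2 * x ^ (β - δ) := by
      rw [mul_left_comm, ← Real.rpow_add hx0, neg_add_eq_sub]
    have h4 := Real.one_le_rpow hx1 (sub_pos.2 hδβ).le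
    linarith
  have hdq : 2 * (d + 1) ≤ q := by
    have : (2 * (d + 1) : ℝ) ≤ q := hnβ.le.trans hq_ge
    exact_mod_cast this
  have hqn : q ≤ n := by
    have h1 : 2 * x ^ β ≤ x := by
      have h2 : x ^ (1 - β) * x ^ β = x := by
        rw [← Real.rpow_add hx0, sub_add_cancel, Real.rpow_one]
      have h3 := mul_le_mul_of_nonneg_right hn1β.le (Real.rpow_nonneg hx0.le β)
      linarith
    have h4 : (q : ℝ) ≤ n := hq_le.trans h1
    exact_mod_cast h4
  have hq0 : 0 < q := by omega
  have hC0 : 0 < C := Nat.ceil_pos.2 (by positivity)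
  have ht0 : 0 < t := Nat.ceil_pos.2 (mul_pos (by positivity) (by exact_mod_cast hq0))
  refine exists_packing_of_parameters hq (by omega) hqn hC0 ht0 (Dvd.intro _ rfl)
    (Nat.le_ceil _) hm_ge ?_ ?_ ?_
  · set p : ℝ := (q.choose (d + 1) : ℝ) / n.choose (d + 1) with hp
    have hp0 : 0 ≤ p := by positivity
    have hpm : m * p ≤ K := by
      have h1 : p ≤ (4 * x ^ (β - 1)) ^ (d + 1) := by
        refine (choose_div_choose_le hn hn0).trans ?_
        have : (q : ℝ) / (n / 2) ≤ 4 * x ^ (β - 1) := by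
          rw [Real.rpow_sub_one hx0.ne', div_le_iff₀ (by positivity)]
          rw [show 4 * (x ^ β / x) * ((n : ℝ) / 2) = 2 * x ^ β by rw [← hx]; field_simp; norm_num]
          exact hq_le
        gcongr
      have h2 : (4 * x ^ (β - 1)) ^ (d + 1)
          = 4 ^ (d + 1) * x ^ (-(((d + 1 : ℕ) : ℝ) - (d + 1 : ℕ) * β)) := by
        rw [mul_pow, ← Real.rpow_natCast (x ^ (β - 1)), ← Real.rpow_mul hx0.le]
        congr 2
        ring
      rw [h2] at h1
      calc m * p ≤ (2 * k * x ^ (((d + 1 : ℕ) : ℝ) - (d + 1 : ℕ) * β)) *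
            (4 ^ (d + 1) * x ^ (-(((d + 1 : ℕ) : ℝ) - (d + 1 : ℕ) * β))) := by gcongr
        _ = K := by
          rw [Real.rpow_neg hx0.le, hK]
          field_simp
    have h1 : (1 + p) ^ m ≤ Real.exp K := by
      calc (1 + p) ^ m ≤ (Real.exp p) ^ m := by
            gcongr
            linarith [Real.add_one_le_exp p]
        _ = Real.exp (m * p) := (Real.exp_nat_mul _ _).symm
        _ ≤ Real.exp K := Real.exp_le_exp.2 hpm
    have h2 : (n.choose (d + 1) : ℝ) ≤ Real.exp ((d + 1) * Real.log x) := by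
      have : (n.choose (d + 1) : ℝ) ≤ x ^ (d + 1) := by
        rw [hx]; exact_mod_cast Nat.choose_le_pow n (d + 1)
      refine this.trans_eq ?_
      rw [← Real.exp_log (pow_pos hx0 (d + 1)), Real.log_pow]
      push_cast
      rfl
    have h3 : (2 : ℝ) ^ C = Real.exp (C * Real.log 2) := by
      rw [Real.exp_nat_mul, Real.exp_log (by norm_num)]
    calc (n.choose (d + 1) : ℝ) * (1 + p) ^ m
        ≤ Real.exp ((d + 1) * Real.log x) * Real.exp K := by gcongr
      _ = Real.exp ((d + 1) * Real.log x + K) := (Real.exp_add _ _).symm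
      _ < Real.exp (C * Real.log 2) := by
        refine Real.exp_lt_exp.2 ?_
        have h4 := mul_lt_mul_of_pos_right (hcov.trans_le hC_ge) hlog2
        have h5 : (K / Real.log 2 + (d + 1) / Real.log 2 * Real.log x) * Real.log 2
            = (d + 1) * Real.log x + K := by field_simp; ring
        linarith
      _ = 2 ^ C := h3.symm
  · have h1 : (m : ℝ) * n.choose d
        ≤ Real.exp (Real.log (2 * k) + 2 * (d + 1) * Real.log x) := by
      have h2 : (m : ℝ) ≤ 2 * k * x ^ (d + 1) := by
        refine hm_le.trans ?_
        rw [← Real.rpow_natCast x (d + 1)]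
        gcongr
        have : (0 : ℝ) ≤ (d + 1 : ℕ) * β := by positivity
        linarith
      have h3 : (n.choose d : ℝ) ≤ x ^ (d + 1) := by
        have : (n.choose d : ℝ) ≤ x ^ d := by rw [hx]; exact_mod_cast Nat.choose_le_pow n d
        exact this.trans (pow_le_pow_right₀ hx1 d.le_succ)
      refine (mul_le_mul h2 h3 (by positivity) (by positivity)).trans_eq ?_
      rw [Real.exp_add, Real.exp_log (by positivity), mul_assoc, ← pow_add,
        ← Real.exp_log (pow_pos hx0 (d + 1 + (d + 1))), Real.log_pow]
      congr 3
      push_cast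
      ring
    have h4 : (2 : ℝ) ^ ((d + 1) * t) = Real.exp (((d + 1) * t : ℕ) * Real.log 2) := by
      rw [Real.exp_nat_mul, Real.exp_log (by norm_num)]
    have h5 : x ^ (β - δ / 2) / 8 ≤ (q - d : ℕ) / (2 * C) := by
      have h6 : (q : ℝ) / 2 ≤ (q - d : ℕ) := by
        rw [Nat.cast_sub (by omega)]
        have : (2 * (d + 1) : ℝ) ≤ q := by exact_mod_cast hdq
        linarith
      rw [Real.rpow_sub hx0]
      calc x ^ β / x ^ (δ / 2) / 8 = x ^ β / 2 / (2 * (2 * x ^ (δ / 2))) := by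
            field_simp; norm_num
        _ ≤ (q - d : ℕ) / (2 * C) := by
          gcongr
          linarith
    have h7 : (((d + 1) * t : ℕ) : ℝ) * Real.log 2 ≤ x ^ (β - δ / 2) / 16 := by
      have h8 : x ^ (β - δ) * x ^ (δ / 2) = x ^ (β - δ / 2) := by
        rw [← Real.rpow_add hx0]; congr 1; ring
      have h9 := mul_le_mul_of_nonneg_left hs.le (Real.rpow_nonneg hx0.le (β - δ))
      rw [h8] at h9
      have h10 : (((d + 1) * t : ℕ) : ℝ) * Real.log 2
          ≤ ((d + 1) * (3 * x ^ (β - δ))) * Real.log 2 := by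
        push_cast
        gcongr
      linarith
    rw [h4, ← Real.exp_add]
    refine (mul_le_mul_of_nonneg_right h1 (Real.exp_nonneg _)).trans_lt ?_
    rw [← Real.exp_add, Real.exp_lt_one_iff]
    linarith
  · have h1 : (q.choose d : ℝ) ≤ (2 * x ^ β) ^ d := by
      have : (q.choose d : ℝ) ≤ (q : ℝ) ^ d := by exact_mod_cast Nat.choose_le_pow q d
      exact this.trans (by gcongr)
    have h2 := div_two_pow_div_factorial_le_choose hn
    have h3 : x ^ (((d + 1 : ℕ) : ℝ) - (d + 1 : ℕ) * β) * ((x ^ β) ^ d * x ^ (β - δ)) * x ^ δ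
        = x ^ (d + 1) := by
      rw [← Real.rpow_natCast (x ^ β), ← Real.rpow_mul hx0.le, ← Real.rpow_add hx0,
        ← Real.rpow_add hx0, ← Real.rpow_add hx0, ← Real.rpow_natCast x (d + 1)]
      congr 1
      push_cast
      ring
    set y := x ^ (((d + 1 : ℕ) : ℝ) - (d + 1 : ℕ) * β) * ((x ^ β) ^ d * x ^ (β - δ)) with hy
    have hy0 : 0 ≤ y := by positivity
    have h4 : 2 * ((m : ℝ) * (q.choose d * t)) ≤ 12 * k * 2 ^ d * y := by
      calc 2 * ((m : ℝ) * (q.choose d * t))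
          ≤ 2 * ((2 * k * x ^ (((d + 1 : ℕ) : ℝ) - (d + 1 : ℕ) * β)) *
            ((2 * x ^ β) ^ d * (3 * x ^ (β - δ)))) := by gcongr
        _ = 12 * k * 2 ^ d * y := by rw [hy, mul_pow]; ring
    have h5 : 12 * k * 2 ^ d * y ≤ (x / 2) ^ (d + 1) / (d + 1).factorial := by
      rw [le_div_iff₀ (by positivity), div_pow, le_div_iff₀ (by positivity), ← h3]
      have := mul_le_mul_of_nonneg_left hhalf.le hy0
      linarith
    have h6 := h4.trans (h5.trans h2)
    exact_mod_cast h6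
end

section
/- The Hajnal–Szemerédi theorem: every graph G on N vertices with maximum degree Δ(G) ≤ k-1 has a proper vertex coloring with k colors in which the sizes of any two color classes differ by at most 1. In particular, if k divides N and Δ(G) < N/k, the complement formulation gives that G has N/k pairwise disjoint independent sets of size k covering all vertices. -/
open Finset
open scoped Classical

namespace HajnalSzemeredi

variable {V ι : Type*}

/-! ### Reachability inside a finite set -/

/-- `i` is joined to `a` by a directed path of `R` all of whose vertices lie in `T`
(the trivial path from `a` to itself is always allowed). -/
def ReachIn (R : ι → ι → Prop) (T : Finset ι) (a i : ι) : Prop :=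
  Relation.ReflTransGen (fun i j => i ∈ T ∧ j ∈ T ∧ R i j) i a

lemma ReachIn.mono {R R' : ι → ι → Prop} {T T' : Finset ι} {a i : ι} (h : ReachIn R T a i)
    (hT : T ⊆ T') (hR : ∀ i ∈ T, ∀ j ∈ T, R i j → R' i j) : ReachIn R' T' a i :=
  Relation.ReflTransGen.mono
    (fun i j hij => ⟨hT hij.1, hT hij.2.1, hR i hij.1 j hij.2.1 hij.2.2⟩) _ _ h

lemma ReachIn.head {R : ι → ι → Prop} {T : Finset ι} {a i j : ι} (h : ReachIn R T a j)
    (hi : i ∈ T) (hj : j ∈ T) (hij : R i j) : ReachIn R T a i :=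
  Relation.ReflTransGen.head ⟨hi, hj, hij⟩ h

lemma ReachIn.mem {R : ι → ι → Prop} {T : Finset ι} {a i : ι} (h : ReachIn R T a i)
    (hi : i ≠ a) : i ∈ T := by
  rcases Relation.ReflTransGen.cases_head h with h | ⟨j, h, -⟩
  · exact absurd h hi
  · exact h.1

lemma ReachIn.mem_target {R : ι → ι → Prop} {T : Finset ι} {a i : ι} (h : ReachIn R T a i)
    (hi : i ≠ a) : a ∈ T := by
  rcases Relation.ReflTransGen.cases_tail h with h | ⟨j, -, h⟩
  · exact absurd h.symm hi
  · exact h.2.1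

lemma ReachIn.filter {R : ι → ι → Prop} {T : Finset ι} {a i : ι} (h : ReachIn R T a i) :
    ReachIn R {j ∈ T | ReachIn R T a j} a i := by
  refine Relation.ReflTransGen.head_induction_on h .refl ?_
  intro i j hij hj ih
  exact ReachIn.head ih (by simpa using ⟨hij.1, ReachIn.head hj hij.1 hij.2.1 hij.2.2⟩)
    (by simpa using ⟨hij.2.1, hj⟩) hij.2.2

lemma ReachIn.erase {R : ι → ι → Prop} {T : Finset ι} {a i w : ι} (h : ReachIn R T a i)
    (hw : ¬ ReachIn R T a w) : ReachIn R (T.erase w) a i := by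
  refine (ReachIn.filter h).mono (fun j hj => ?_) fun _ _ _ _ h => h
  rw [mem_filter] at hj
  refine mem_erase.2 ⟨?_, hj.1⟩
  rintro rfl
  exact hw hj.2

/-- The first step of a path that never returns to its starting point. -/
lemma ReachIn.exists_step {R : ι → ι → Prop} {T : Finset ι} {a i : ι} (h : ReachIn R T a i)
    (hi : i ≠ a) : ∃ j ∈ T.erase i, R i j ∧ ReachIn R (T.erase i) a j := by
  have key : ∀ x, ReachIn R T a x →
      ReachIn R (T.erase i) a x ∨ ∃ j ∈ T.erase i, R i j ∧ ReachIn R (T.erase i) a j := by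
    intro x hx
    refine Relation.ReflTransGen.head_induction_on hx (Or.inl .refl) ?_
    intro x y hxy _ ih
    rcases ih with ih | ih
    · have hy : y ≠ i := by
        rintro rfl
        exact (mem_erase.1 (ih.mem hi)).1 rfl
      have hyT := mem_erase.2 ⟨hy, hxy.2.1⟩
      by_cases hxi : x = i
      · subst hxi
        exact Or.inr ⟨y, hyT, hxy.2.2, ih⟩
      · exact Or.inl (ih.head (mem_erase.2 ⟨hxi, hxy.1⟩) hyT hxy.2.2)
    · exact Or.inr ih
  rcases key i h with h' | h'
  · exact absurd rfl (mem_erase.1 (h'.mem hi)).1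
  · exact h'

/-- If every element of `A` reaches `a`, then some nonempty `A' ⊆ A` consists of elements whose
deletion does not disconnect the others from `a`, and `R` leads from `A'` to a single element
outside `A'` only. -/
lemma exists_terminal {R : ι → ι → Prop} {A : Finset ι} {a b : ι} (ha : a ∈ A)
    (hA : ∀ i ∈ A, ReachIn R A a i) (hb : b ∈ A) (hba : b ≠ a) :
    ∃ U ∈ A, ∃ A' ⊆ A, A'.Nonempty ∧ U ∉ A' ∧ a ∉ A' ∧
      (∀ W ∈ A', ∀ X ∈ A, X ≠ W → ReachIn R (A.erase W) a X) ∧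
      (∀ W ∈ A', ∀ X ∈ A, X ∉ A' → X ≠ U → ¬ R W X) := by
  let T : ι → Finset ι := fun U => {i ∈ A.erase U | ¬ ReachIn R (A.erase U) a i}
  have hT : ∀ U i, i ∈ T U ↔ (i ≠ U ∧ i ∈ A) ∧ ¬ ReachIn R (A.erase U) a i := by
    intro U i
    simp [T]
  have hne : ({U ∈ A | (T U).Nonempty} : Finset ι).Nonempty := by
    refine ⟨a, mem_filter.2 ⟨ha, b, (hT _ _).2 ⟨⟨hba, hb⟩, fun h => ?_⟩⟩⟩
    exact (mem_erase.1 (h.mem_target hba)).1 rfl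
  obtain ⟨U, hU, hmin⟩ := exists_min_image _ (fun U => (T U).card) hne
  rw [mem_filter] at hU
  refine ⟨U, hU.1, T U, fun i hi => ((hT _ _).1 hi).1.2, hU.2, fun h => ((hT _ _).1 h).1.1 rfl,
    fun h => ((hT _ _).1 h).2 .refl, ?_, ?_⟩
  · intro W hW X hX hXW
    by_contra hcon
    have hW' := (hT _ _).1 hW
    have hle := hmin W (mem_filter.2 ⟨hW'.1.2, X, (hT _ _).2 ⟨⟨hXW, hX⟩, hcon⟩⟩)
    refine absurd (card_lt_card ?_) (not_lt.2 hle)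
    refine (ssubset_iff_of_subset ?_).2 ⟨W, hW, fun h => ((hT _ _).1 h).1.1 rfl⟩
    intro Y hY
    have hY' := (hT _ _).1 hY
    by_contra hYU
    apply hY'.2
    have hsub : (A.erase U).erase W ⊆ A.erase W := erase_subset_erase _ (erase_subset _ _)
    by_cases hYe : Y = U
    · subst hYe
      by_cases hYa : Y = a
      · subst hYa
        exact .refl
      · obtain ⟨j, hj, hYj, hreach⟩ := (hA Y hY'.1.2).exists_step hYa
        have hjW : j ≠ W := by
          rintro rfl
          exact hW'.2 hreach
        exact ((hreach.erase hW'.2).mono hsub fun _ _ _ _ h => h).head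
          (mem_erase.2 hY'.1) (mem_erase.2 ⟨hjW, (mem_erase.1 hj).2⟩) hYj
    · have hr : ReachIn R (A.erase U) a Y := by
        by_contra hr
        exact hYU ((hT _ _).2 ⟨⟨hYe, hY'.1.2⟩, hr⟩)
      exact (hr.erase hW'.2).mono hsub fun _ _ _ _ h => h
  · intro W hW X hX hXT hXU hWX
    have hW' := (hT _ _).1 hW
    have hr : ReachIn R (A.erase U) a X := by
      by_contra hr
      exact hXT ((hT _ _).2 ⟨⟨hXU, hX⟩, hr⟩)
    exact hW'.2 (hr.head (mem_erase.2 hW'.1) (mem_erase.2 ⟨hXU, hX⟩) hWX)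

/-! ### Colorings of a finite set of vertices -/

/-- `c` properly colors the subgraph of `G` induced on `S` with colors from `C`. -/
structure IsProperOn (G : SimpleGraph V) (S : Finset V) (C : Finset ι) (c : V → ι) : Prop where
  mem : ∀ v ∈ S, c v ∈ C
  ne : ∀ v ∈ S, ∀ w ∈ S, G.Adj v w → c v ≠ c w

/-- `v` has no neighbor of color `i` in `S`. -/
def Movable (G : SimpleGraph V) (S : Finset V) (c : V → ι) (v : V) (i : ι) : Prop :=
  ∀ w ∈ S, c w = i → ¬ G.Adj v w

/-- Some vertex of color `i` in `S` has no neighbor of color `j` in `S`. -/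
def Step (G : SimpleGraph V) (S : Finset V) (c : V → ι) (i j : ι) : Prop :=
  ∃ v ∈ S, c v = i ∧ Movable G S c v j

lemma IsProperOn.insert {G : SimpleGraph V} {S : Finset V} {C : Finset ι} {c : V → ι}
    (h : IsProperOn G S C c) {z : V} {i : ι} (hz : z ∉ S) (hi : i ∈ C)
    (hm : Movable G S c z i) : IsProperOn G (insert z S) C (Function.update c z i) := by
  have hu : ∀ v ∈ S, Function.update c z i v = c v := fun v hv =>
    Function.update_of_ne (by rintro rfl; exact hz hv) _ _
  constructor
  · intro v hv
    rcases mem_insert.1 hv with rfl | hv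
    · simpa using hi
    · rw [hu v hv]
      exact h.mem v hv
  · intro v hv w hw hvw
    rcases mem_insert.1 hv with rfl | hv' <;> rcases mem_insert.1 hw with rfl | hw'
    · exact absurd hvw G.irrefl
    · rw [hu w hw', Function.update_self]
      exact fun e => hm w hw' e.symm hvw
    · rw [hu v hv', Function.update_self]
      exact fun e => hm v hv' e hvw.symm
    · rw [hu v hv', hu w hw']
      exact h.ne v hv' w hw' hvw

lemma IsProperOn.subset {G : SimpleGraph V} {S S' : Finset V} {C : Finset ι} {c : V → ι}
    (h : IsProperOn G S C c) (hS : S' ⊆ S) : IsProperOn G S' C c :=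
  ⟨fun v hv => h.mem v (hS hv), fun v hv w hw => h.ne v (hS hv) w (hS hw)⟩

lemma card_filter_update {S : Finset V} {c : V → ι} {z : V} (hz : z ∉ S) (i j : ι) :
    #{v ∈ insert z S | Function.update c z i v = j} =
      #{v ∈ S | c v = j} + if j = i then 1 else 0 := by
  have : ∀ v ∈ S, Function.update c z i v = c v := fun v hv =>
    Function.update_of_ne (by rintro rfl; exact hz hv) _ _
  rw [card_filter, card_filter, sum_insert hz, add_comm, Function.update_self]
  congr 1
  · exact sum_congr rfl fun v hv => by rw [this v hv]
  · simp [eq_comm]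

/-- A vertex that fits into a class from which `a` can be reached can be added to the coloring at
the cost of enlarging the class `a`. -/
lemma exists_insert {G : SimpleGraph V} {C : Finset ι} {a : ι} (T : Finset ι) :
    ∀ (S : Finset V) (c : V → ι) (z : V) (X : ι), T ⊆ C → X ∈ C → z ∉ S → IsProperOn G S C c →
      Movable G S c z X → ReachIn (Step G S c) T a X →
      ∃ c' : V → ι, IsProperOn G (insert z S) C c' ∧
        ∀ i, #{v ∈ insert z S | c' v = i} = #{v ∈ S | c v = i} + if i = a then 1 else 0 := by
  induction T using Finset.strongInduction with
  | H T ih =>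
  intro S c z X hT hX hz hc hm hr
  by_cases hXa : X = a
  · subst hXa
    exact ⟨_, hc.insert hz hX hm, card_filter_update hz X⟩
  obtain ⟨j, hj, ⟨x, hxS, hxX, hxm⟩, hjr⟩ := hr.exists_step hXa
  have hj' := mem_erase.1 hj
  have hzx : z ∉ S.erase x := fun h => hz (mem_of_mem_erase h)
  have hne : z ≠ x := by
    rintro rfl
    exact hz hxS
  have hsub : S.erase x ⊆ S := erase_subset _ _
  have hu : ∀ v ∈ S, Function.update c z X v = c v := fun v hv =>
    Function.update_of_ne (by rintro rfl; exact hz hv) _ _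
  have hmov : ∀ v k, k ≠ X → Movable G S c v k →
      Movable G (insert z (S.erase x)) (Function.update c z X) v k := by
    intro v k hk hv w hw hwk
    rcases mem_insert.1 hw with rfl | hw
    · rw [Function.update_self] at hwk
      exact absurd hwk.symm hk
    · rw [hu w (hsub hw)] at hwk
      exact hv w (hsub hw) hwk
  obtain ⟨c', hc', hcard⟩ := ih (T.erase X) (erase_ssubset (hr.mem hXa)) (insert z (S.erase x))
    (Function.update c z X) x j ((erase_subset _ _).trans hT) (hT hj'.2)
    (by simp [hne.symm])
    ((hc.subset hsub).insert hzx hX fun w hw => hm w (hsub hw))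
    (hmov x j hj'.1 hxm)
    (hjr.mono subset_rfl (by
      rintro i hi k hk ⟨v, hv, hvi, hvm⟩
      have hvx : v ≠ x := by
        rintro rfl
        exact (mem_erase.1 hi).1 (hvi.symm.trans hxX)
      exact ⟨v, mem_insert_of_mem (mem_erase.2 ⟨hvx, hv⟩), (hu v hv).trans hvi,
        hmov v k (mem_erase.1 hk).1 hvm⟩))
  rw [Finset.insert_comm, insert_erase hxS] at hc' hcard
  refine ⟨c', hc', fun i => ?_⟩
  rw [hcard, card_filter_update hzx]
  congr 1
  conv_rhs => rw [← insert_erase hxS, filter_insert]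
  by_cases hi : i = X
  · subst hi
    simp [hxX]
  · rw [if_neg hi, if_neg (by rw [hxX]; exact fun e => hi e.symm), add_zero]

/-! ### The discharging argument -/

/-- Let the classes `P i`, `i ∈ A`, and the set `B` satisfy the degree conditions of the
Kierstead–Kostochka argument. Then some `y ∈ B` has a unique neighbor `z` in some class `P W` with
`W ∈ A'`, such that `z` fits into another class or is the unique neighbor in `P W` of a second
vertex of `B` not adjacent to `y`. -/
lemma exists_solo {G : SimpleGraph V} {A A' : Finset ι} {U : ι} {P : ι → Finset V}
    {B : Finset V} {s m q : ℕ} (hA : #A = m + 1) (hA' : A' ⊆ A) (hne : A'.Nonempty) (hU : U ∈ A)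
    (hUA' : U ∉ A') (hs : ∀ W ∈ A', #(P W) ≤ s) (hB : q * s + 1 ≤ #B)
    (hBA : ∀ y ∈ B, ∀ i ∈ A, 1 ≤ #{x ∈ P i | G.Adj y x})
    (hAA : ∀ W ∈ A', ∀ x ∈ P W, ∀ i ∈ A, i ∉ A' → i ≠ U → 1 ≤ #{w ∈ P i | G.Adj x w})
    (hdegB : ∀ y ∈ B, #{w ∈ B | G.Adj y w} + ∑ i ∈ A, #{x ∈ P i | G.Adj y x} ≤ m + q)
    (hdegA : ∀ W ∈ A', ∀ x ∈ P W,
      #{w ∈ B | G.Adj x w} + ∑ i ∈ A, #{w ∈ P i | G.Adj x w} ≤ m + q) :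
    ∃ W ∈ A', ∃ z ∈ P W, ∃ y ∈ B, {x ∈ P W | G.Adj y x} = {z} ∧
      ((∃ X ∈ A, X ≠ W ∧ ∀ w ∈ P X, ¬ G.Adj z w) ∨
        ∃ y' ∈ B, y' ≠ y ∧ {x ∈ P W | G.Adj y' x} = {z} ∧ ¬ G.Adj y y') := by
  by_contra! hcon
  have hUt : #(A \ insert U A') + (#A' + 1) = m + 1 := by
    rw [← hA, ← card_insert_of_notMem hUA']
    exact card_sdiff_add_card_eq_card (insert_subset hU hA')
  have hadj : ∀ W, ∀ y ∈ B, ∀ z, {x ∈ P W | G.Adj y x} = {z} → z ∈ P W ∧ G.Adj y z := by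
    intro W y _ z h
    have : z ∈ ({x ∈ P W | G.Adj y x} : Finset V) := by simp [h]
    simpa using this
  -- a solo vertex has few neighbors in `B`
  have hsolo : ∀ W ∈ A', ∀ z, ({y ∈ B | {x ∈ P W | G.Adj y x} = {z}} : Finset V).Nonempty →
      #{w ∈ B | G.Adj z w} ≤ q := by
    rintro W hW z ⟨y, hy⟩
    rw [mem_filter] at hy
    have hz := (hadj W y hy.1 z hy.2).1
    have h1 := (hcon W hW z hz y hy.1 hy.2).1
    have h2 : #(A.erase W) ≤ ∑ i ∈ A, #{w ∈ P i | G.Adj z w} := by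
      refine le_trans ?_ (sum_le_sum_of_subset (erase_subset W A))
      rw [card_eq_sum_ones]
      refine sum_le_sum fun X hX => ?_
      obtain ⟨w, hw, hzw⟩ := h1 X (mem_of_mem_erase hX) (ne_of_mem_erase hX)
      exact card_pos.2 ⟨w, mem_filter.2 ⟨hw, hzw⟩⟩
    rw [card_erase_of_mem (hA' hW), hA] at h2
    have := hdegA W hW z hz
    omega
  have htq : q < #A' := by
    by_contra! hle
    obtain ⟨W, hW⟩ := hne
    let w : V → ℕ := fun x =>
      if ({y ∈ B | {x' ∈ P W | G.Adj y x'} = {x}} : Finset V).Nonempty then 2 else 1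
    have hlow : ∀ y ∈ B, 2 ≤ ∑ x ∈ P W with G.Adj y x, w x := by
      intro y hy
      rcases (hBA y hy W (hA' hW)).eq_or_lt with h | h
      · obtain ⟨z, hz⟩ := card_eq_one.1 h.symm
        rw [hz, sum_singleton]
        simp only [w]
        rw [if_pos ⟨y, mem_filter.2 ⟨hy, hz⟩⟩]
      · refine le_trans (Nat.succ_le_of_lt h) ?_
        rw [card_eq_sum_ones]
        refine sum_le_sum fun x _ => ?_
        simp only [w]
        split_ifs <;> norm_num
    have hswap : ∑ y ∈ B, ∑ x ∈ P W with G.Adj y x, w x =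
        ∑ x ∈ P W, ∑ y ∈ B with G.Adj x y, w x :=
      sum_comm' fun y x => by simp only [mem_filter, G.adj_comm x y]; tauto
    have hup : ∀ x ∈ P W, ∑ y ∈ B with G.Adj x y, w x ≤ 2 * q := by
      intro x hx
      rw [sum_const, smul_eq_mul]
      simp only [w]
      split_ifs with h
      · have := hsolo W hW x h
        omega
      · have h2 : #(A \ insert U A') ≤ ∑ i ∈ A, #{w ∈ P i | G.Adj x w} := by
          refine le_trans ?_ (sum_le_sum_of_subset (sdiff_subset (t := insert U A')))
          rw [card_eq_sum_ones]
          refine sum_le_sum fun X hX => ?_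
          simp only [mem_sdiff, mem_insert, not_or] at hX
          exact hAA W hW x hx X hX.1 hX.2.2 hX.2.1
        have := hdegA W hW x hx
        omega
    have h1 : #B * 2 ≤ #(P W) * (2 * q) := by
      calc #B * 2 = ∑ y ∈ B, 2 := by rw [sum_const, smul_eq_mul]
        _ ≤ ∑ y ∈ B, ∑ x ∈ P W with G.Adj y x, w x := sum_le_sum hlow
        _ = _ := hswap
        _ ≤ ∑ x ∈ P W, 2 * q := sum_le_sum hup
        _ = _ := by rw [sum_const, smul_eq_mul]
    have h2 : #(P W) * (2 * q) ≤ s * (2 * q) := Nat.mul_le_mul_right _ (hs W hW)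
    nlinarith
  -- the weight of an edge from `z` to `y` is `q` over the number of solo neighbors of `z`
  let S : ι → V → Finset V := fun W z => {y ∈ B | {x ∈ P W | G.Adj y x} = {z}}
  have hlow : ∀ y ∈ B, (#A' : ℚ) ≤
      ∑ W ∈ A', ∑ z ∈ P W with {x ∈ P W | G.Adj y x} = {z}, (q : ℚ) / #(S W z) := by
    intro y hy
    set d := #{w ∈ B | G.Adj y w} with hd
    have hdeg := hdegB y hy
    rw [← hd] at hdeg
    have hsum : #A ≤ ∑ i ∈ A, #{x ∈ P i | G.Adj y x} := by
      rw [card_eq_sum_ones]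
      exact sum_le_sum fun i hi => hBA y hy i hi
    have hdq : d + 1 ≤ q := by omega
    let Y : Finset ι := {W ∈ A' | #{x ∈ P W | G.Adj y x} = 1}
    have hY : #A + #A' ≤ ∑ i ∈ A, #{x ∈ P i | G.Adj y x} + #Y := by
      have e1 : #A' = ∑ i ∈ A, if i ∈ A' then 1 else 0 := by
        rw [← card_filter, filter_mem_eq_inter, inter_eq_right.2 hA']
      have e2 : #Y = ∑ i ∈ A, if i ∈ Y then 1 else 0 := by
        rw [← card_filter, filter_mem_eq_inter,
          inter_eq_right.2 ((filter_subset _ _).trans hA')]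
      rw [e1, e2, card_eq_sum_ones, ← sum_add_distrib, ← sum_add_distrib]
      refine sum_le_sum fun i hi => ?_
      have := hBA y hy i hi
      by_cases h1 : i ∈ A' <;> by_cases h2 : #{x ∈ P i | G.Adj y x} = 1 <;>
        simp only [Y, mem_filter, h1, h2, and_true, and_false, if_true, if_false] <;> omega
    have hterm : ∀ W ∈ A', (if W ∈ Y then (q : ℚ) / (d + 1) else 0) ≤
        ∑ z ∈ P W with {x ∈ P W | G.Adj y x} = {z}, (q : ℚ) / #(S W z) := by
      intro W hW
      split_ifs with h
      · obtain ⟨z, hz⟩ := card_eq_one.1 (mem_filter.1 h).2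
        have hzP := hadj W y hy z hz
        refine le_trans ?_ (single_le_sum (f := fun z => (q : ℚ) / #(S W z))
          (fun i _ => by positivity) (mem_filter.2 ⟨hzP.1, hz⟩))
        have hyS : y ∈ S W z := mem_filter.2 ⟨hy, hz⟩
        have hcard : #(S W z) ≤ d + 1 := by
          have hsub : S W z ⊆ insert y ({w ∈ B | G.Adj y w} : Finset V) := by
            intro y' hy'
            have hy'' := mem_filter.1 hy'
            by_cases e : y' = y
            · simp [e]
            · exact mem_insert_of_mem (mem_filter.2
                ⟨hy''.1, (hcon W hW z hzP.1 y hy hz).2 y' hy''.1 e hy''.2⟩)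
          exact (card_le_card hsub).trans (card_insert_le _ _)
        have hpos : (0 : ℚ) < #(S W z) := by exact_mod_cast card_pos.2 ⟨y, hyS⟩
        exact div_le_div_of_nonneg_left (by positivity) hpos (by exact_mod_cast hcard)
      · exact sum_nonneg fun i _ => by positivity
    refine le_trans ?_ (sum_le_sum hterm)
    rw [← sum_filter, filter_mem_eq_inter, inter_eq_right.2 (filter_subset _ _), sum_const,
      nsmul_eq_mul, mul_div_assoc', le_div_iff₀ (by positivity)]
    have hYd : #A' + d + 1 ≤ #Y + q := by omega
    have h1 : (#A' : ℚ) + d + 1 ≤ #Y + q := by exact_mod_cast hYd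
    have h2 : (d : ℚ) + 1 ≤ q := by exact_mod_cast hdq
    have h3 : (q : ℚ) ≤ #A' := by exact_mod_cast htq.le
    nlinarith [mul_nonneg (sub_nonneg.2 h3) (sub_nonneg.2 h2),
      mul_le_mul_of_nonneg_right h1 (Nat.cast_nonneg (α := ℚ) q)]
  have hswap : ∑ y ∈ B, ∑ W ∈ A', ∑ z ∈ P W with {x ∈ P W | G.Adj y x} = {z},
      (q : ℚ) / #(S W z) = ∑ W ∈ A', ∑ z ∈ P W, ∑ y ∈ S W z, (q : ℚ) / #(S W z) := by
    rw [sum_comm]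
    refine sum_congr rfl fun W _ => sum_comm' fun y z => ?_
    simp only [S, mem_filter]
    tauto
  have hup : ∑ W ∈ A', ∑ z ∈ P W, ∑ y ∈ S W z, (q : ℚ) / #(S W z) ≤ #A' * (s * q) := by
    rw [← nsmul_eq_mul]
    refine sum_le_card_nsmul _ _ _ fun W hW => ?_
    have : ∀ z ∈ P W, ∑ y ∈ S W z, (q : ℚ) / #(S W z) ≤ q := by
      intro z _
      rw [sum_const, nsmul_eq_mul]
      rcases eq_or_ne (#(S W z) : ℚ) 0 with h | h
      · rw [h]
        simp
      · rw [mul_div_cancel₀ _ h]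
    refine (sum_le_card_nsmul _ _ _ this).trans ?_
    rw [nsmul_eq_mul]
    exact mul_le_mul_of_nonneg_right (by exact_mod_cast hs W hW) (by positivity)
  have htot : (#B : ℚ) * #A' ≤ #A' * (s * q) := by
    rw [← nsmul_eq_mul]
    exact (card_nsmul_le_sum _ _ _ hlow).trans (hswap.le.trans hup)
  have hpos : (0 : ℚ) < #A' := by exact_mod_cast card_pos.2 hne
  have hB' : (q : ℚ) * s + 1 ≤ #B := by exact_mod_cast hB
  nlinarith

/-! ### Nearly equitable colorings -/

/-- `c` properly colors the subgraph of `G` induced on `S` so that each color of `C` is used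
exactly `s` times. -/
structure IsEquitableOn (G : SimpleGraph V) (S : Finset V) (C : Finset ι) (s : ℕ) (c : V → ι) :
    Prop extends IsProperOn G S C c where
  card : ∀ i ∈ C, #{v ∈ S | c v = i} = s

/-- `c` is a proper coloring of all vertices of `S` but `u`, in which each color of `C` is used
`s` times, except for `a`, which is used `s - 1` times. -/
structure IsNearEquitable (G : SimpleGraph V) (S : Finset V) (C : Finset ι) (s : ℕ) (a : ι)
    (u : V) (c : V → ι) : Prop extends IsProperOn G (S.erase u) C c where
  mem_u : u ∈ S
  card : ∀ i ∈ C, (#{v ∈ S.erase u | c v = i} + if i = a then 1 else 0) = s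

/-- The colors from which `a` can be reached by moving single vertices between classes. -/
noncomputable def accessible (G : SimpleGraph V) (S : Finset V) (C : Finset ι) (a : ι)
    (c : V → ι) : Finset ι :=
  {i ∈ C | ReachIn (Step G S c) C a i}

lemma IsNearEquitable.exists_equitable_of_movable {G : SimpleGraph V} {S : Finset V}
    {C : Finset ι} {s : ℕ} {a i : ι} {u : V} {c : V → ι} (h : IsNearEquitable G S C s a u c)
    (hi : i ∈ accessible G (S.erase u) C a c) (hm : Movable G (S.erase u) c u i) :
    ∃ c' : V → ι, IsEquitableOn G S C s c' := by
  have hi' := mem_filter.1 hi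
  obtain ⟨c', hc', hcard⟩ := exists_insert C (S.erase u) c u i subset_rfl hi'.1
    (notMem_erase u S) h.toIsProperOn hm hi'.2
  rw [insert_erase h.mem_u] at hc' hcard
  exact ⟨c', hc', fun j hj => (hcard j).trans (h.card j hj)⟩

lemma IsProperOn.exists_union {G : SimpleGraph V} {S₁ S₂ : Finset V} {C₁ C₂ : Finset ι}
    {c₁ c₂ : V → ι} (h₁ : IsProperOn G S₁ C₁ c₁) (h₂ : IsProperOn G S₂ C₂ c₂)
    (hS : Disjoint S₁ S₂) (hC : Disjoint C₁ C₂) :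
    ∃ c : V → ι, (∀ v ∈ S₁, c v = c₁ v) ∧ (∀ v ∈ S₂, c v = c₂ v) ∧
      IsProperOn G (S₁ ∪ S₂) (C₁ ∪ C₂) c ∧
      (∀ i ∈ C₁, #{v ∈ S₁ ∪ S₂ | c v = i} = #{v ∈ S₁ | c₁ v = i}) ∧
      (∀ i ∈ C₂, #{v ∈ S₁ ∪ S₂ | c v = i} = #{v ∈ S₂ | c₂ v = i}) := by
  let c : V → ι := fun v => if v ∈ S₂ then c₂ v else c₁ v
  have e₁ : ∀ v ∈ S₁, c v = c₁ v := fun v hv => if_neg (disjoint_left.1 hS hv)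
  have e₂ : ∀ v ∈ S₂, c v = c₂ v := fun v hv => if_pos hv
  refine ⟨c, e₁, e₂, ⟨?_, ?_⟩, ?_, ?_⟩
  · intro v hv
    rcases mem_union.1 hv with hv | hv
    · exact mem_union_left _ (e₁ v hv ▸ h₁.mem v hv)
    · exact mem_union_right _ (e₂ v hv ▸ h₂.mem v hv)
  · intro v hv w hw hvw
    rcases mem_union.1 hv with hv | hv <;> rcases mem_union.1 hw with hw | hw
    · rw [e₁ v hv, e₁ w hw]
      exact h₁.ne v hv w hw hvw
    · rw [e₁ v hv, e₂ w hw]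
      exact fun e => disjoint_left.1 hC (h₁.mem v hv) (e ▸ h₂.mem w hw)
    · rw [e₂ v hv, e₁ w hw]
      exact fun e => disjoint_left.1 hC (h₁.mem w hw) (e ▸ h₂.mem v hv)
    · rw [e₂ v hv, e₂ w hw]
      exact h₂.ne v hv w hw hvw
  · intro i hi
    congr 1
    ext v
    simp only [mem_filter, mem_union]
    constructor
    · rintro ⟨hv | hv, hvi⟩
      · exact ⟨hv, (e₁ v hv).symm.trans hvi⟩
      · rw [e₂ v hv] at hvi
        exact absurd (hvi ▸ h₂.mem v hv) (disjoint_left.1 hC hi)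
    · rintro ⟨hv, hvi⟩
      exact ⟨Or.inl hv, (e₁ v hv).trans hvi⟩
  · intro i hi
    congr 1
    ext v
    simp only [mem_filter, mem_union]
    constructor
    · rintro ⟨hv | hv, hvi⟩
      · rw [e₁ v hv] at hvi
        exact absurd hi (disjoint_left.1 hC (hvi ▸ h₁.mem v hv))
      · exact ⟨hv, (e₂ v hv).symm.trans hvi⟩
    · rintro ⟨hv, hvi⟩
      exact ⟨Or.inr hv, (e₂ v hv).trans hvi⟩

lemma card_filter_mem_eq_sum (S : Finset V) (c : V → ι) (A : Finset ι) :
    #{v ∈ S | c v ∈ A} = ∑ i ∈ A, #{v ∈ S | c v = i} := by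
  rw [card_eq_sum_card_fiberwise (s := {v ∈ S | c v ∈ A}) (f := c) (t := A)
    fun v hv => (mem_filter.1 hv).2]
  refine sum_congr rfl fun i hi => ?_
  rw [filter_filter]
  congr 1
  ext v
  simp only [mem_filter]
  constructor
  · tauto
  · rintro ⟨hv, rfl⟩
    exact ⟨hv, hi, rfl⟩

/-- A nearly equitable coloring can be completed, or replaced by one with more accessible
classes. -/
lemma IsNearEquitable.exists_equitable_or_improve {G : SimpleGraph V} {S : Finset V}
    {C : Finset ι} {s : ℕ} {a : ι} {u : V} {c : V → ι} (ha : a ∈ C)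
    (hdeg : ∀ v ∈ S, #{w ∈ S | G.Adj v w} < #C)
    (ih : ∀ C' ⊂ C, ∀ S' ⊆ S, #S' = s * #C' → (∀ v ∈ S', #{w ∈ S' | G.Adj v w} < #C') →
      ∃ c' : V → ι, IsEquitableOn G S' C' s c')
    (h : IsNearEquitable G S C s a u c) :
    (∃ c' : V → ι, IsEquitableOn G S C s c') ∨
      ∃ (u' : V) (c' : V → ι), IsNearEquitable G S C s a u' c' ∧
        accessible G (S.erase u) C a c ⊂ accessible G (S.erase u') C a c' := by
  by_cases hmov : ∃ i ∈ accessible G (S.erase u) C a c, Movable G (S.erase u) c u i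
  · obtain ⟨i, hi, hm⟩ := hmov
    exact Or.inl (h.exists_equitable_of_movable hi hm)
  push Not at hmov
  set A := accessible G (S.erase u) C a c with hAdef
  have hAC : A ⊆ C := filter_subset _ _
  have haA : a ∈ A := mem_filter.2 ⟨ha, .refl⟩
  have hAreach : ∀ i ∈ A, ReachIn (Step G (S.erase u) c) A a i :=
    fun i hi => (mem_filter.1 hi).2.filter
  let P : ι → Finset V := fun i => {v ∈ S.erase u | c v = i}
  let B : Finset V := insert u {v ∈ S.erase u | c v ∈ C \ A}
  let A₀ : Finset V := {v ∈ S.erase u | c v ∈ A}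
  have hA₀S : ∀ v ∈ A₀, v ∈ S.erase u := fun v hv => (mem_filter.1 hv).1
  have hA₀A : ∀ v ∈ A₀, c v ∈ A := fun v hv => (mem_filter.1 hv).2
  have hB : ∀ v, v ∈ B ↔ v = u ∨ v ∈ S.erase u ∧ c v ∈ C ∧ c v ∉ A := by
    intro v
    simp only [B, mem_insert, mem_filter, mem_sdiff]
  have hdisj : Disjoint A₀ B := by
    refine disjoint_left.2 fun v hv hvB => ?_
    rcases (hB v).1 hvB with rfl | hv'
    · exact notMem_erase _ _ (hA₀S _ hv)
    · exact hv'.2.2 (hA₀A v hv)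
  have hunion : A₀ ∪ B = S := by
    ext v
    rw [mem_union, hB]
    constructor
    · rintro (hv | rfl | hv)
      · exact mem_of_mem_erase (hA₀S v hv)
      · exact h.mem_u
      · exact mem_of_mem_erase hv.1
    · intro hv
      by_cases hvu : v = u
      · exact Or.inr (Or.inl hvu)
      · have hv' : v ∈ S.erase u := mem_erase.2 ⟨hvu, hv⟩
        by_cases hvA : c v ∈ A
        · exact Or.inl (mem_filter.2 ⟨hv', hvA⟩)
        · exact Or.inr (Or.inr ⟨hv', h.mem v hv', hvA⟩)
  have hBS : B ⊆ S := hunion ▸ subset_union_right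
  have hBcard : #B = s * #(C \ A) + 1 := by
    rw [card_insert_of_notMem fun hu => notMem_erase u S (mem_filter.1 hu).1,
      card_filter_mem_eq_sum, mul_comm, ← smul_eq_mul, ← sum_const]
    congr 1
    refine sum_congr rfl fun i hi => ?_
    have hi' := mem_sdiff.1 hi
    rw [← h.card i hi'.1, if_neg (by rintro rfl; exact hi'.2 haA), add_zero]
  have hCcard : #(C \ A) + #A = #C := card_sdiff_add_card_eq_card hAC
  have hBA : ∀ y ∈ B, ∀ i ∈ A, 1 ≤ #{x ∈ P i | G.Adj y x} := by
    intro y hy i hi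
    have : ¬ Movable G (S.erase u) c y i := by
      rcases (hB y).1 hy with rfl | hy
      · exact hmov i hi
      · exact fun hm => hy.2.2 (mem_filter.2 ⟨hy.2.1,
          ((mem_filter.1 hi).2).head hy.2.1 (hAC hi) ⟨y, hy.1, rfl, hm⟩⟩)
    simp only [Movable, not_forall, not_not] at this
    obtain ⟨w, hw, hwi, hyw⟩ := this
    exact card_pos.2 ⟨w, mem_filter.2 ⟨mem_filter.2 ⟨hw, hwi⟩, hyw⟩⟩
  have hsplit : ∀ v, #{w ∈ B | G.Adj v w} + ∑ i ∈ A, #{x ∈ P i | G.Adj v x} =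
      #{w ∈ S | G.Adj v w} := by
    intro v
    have e : ∑ i ∈ A, #{x ∈ P i | G.Adj v x} = #{w ∈ A₀ | G.Adj v w} := by
      simp only [P, A₀]
      rw [filter_comm, card_filter_mem_eq_sum]
      exact sum_congr rfl fun i _ => by rw [filter_comm]
    rw [e, add_comm, ← hunion, filter_union, card_union_of_disjoint]
    exact disjoint_filter_filter hdisj
  have hdegC : ∀ v ∈ S, #{w ∈ B | G.Adj v w} + ∑ i ∈ A, #{x ∈ P i | G.Adj v x} + 1 ≤ #C :=
    fun v hv => (hsplit v).symm ▸ hdeg v hv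
  have hPS : ∀ i, P i ⊆ S := fun i => (filter_subset _ _).trans (erase_subset _ _)
  have hb : ∃ b ∈ A, b ≠ a := by
    by_contra! hcon
    have hA1 : A = {a} := eq_singleton_iff_unique_mem.2 ⟨haA, hcon⟩
    have h1 : #B ≤ ∑ y ∈ B, ∑ x ∈ P a with G.Adj y x, 1 := by
      rw [card_eq_sum_ones]
      exact sum_le_sum fun y hy => by rw [← card_eq_sum_ones]; exact hBA y hy a haA
    have h2 : ∑ y ∈ B, ∑ x ∈ P a with G.Adj y x, 1 = ∑ x ∈ P a, ∑ y ∈ B with G.Adj x y, 1 :=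
      sum_comm' fun y x => by simp only [mem_filter, G.adj_comm x y]; tauto
    have h3 : ∑ x ∈ P a, ∑ y ∈ B with G.Adj x y, 1 ≤ #(P a) * #(C \ A) := by
      rw [← smul_eq_mul]
      refine sum_le_card_nsmul _ _ _ fun x hx => ?_
      have := hdegC x (hPS a hx)
      rw [← card_eq_sum_ones]
      have : #A = 1 := by rw [hA1, card_singleton]
      omega
    have h4 : #(P a) + 1 = s := by simpa using h.card a ha
    have h5 : #(P a) * #(C \ A) ≤ s * #(C \ A) := Nat.mul_le_mul_right _ (by omega)
    omega
  obtain ⟨b, hbA, hba⟩ := hb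
  obtain ⟨U, hU, A', hA', hne, hUA', haA', hterm, hout⟩ :=
    exists_terminal haA hAreach hbA hba
  have hApos : 0 < #A := card_pos.2 ⟨a, haA⟩
  obtain ⟨W, hW, z, hz, y, hy, hyz, hcase⟩ := exists_solo (G := G) (A := A) (A' := A') (U := U)
    (P := P) (B := B) (s := s) (m := #A - 1) (q := #(C \ A)) (by omega) hA' hne hU hUA'
    (fun W hW => by rw [← h.card W (hAC (hA' hW))]; exact Nat.le_add_right _ _)
    (by rw [hBcard, mul_comm]) hBA
    (by
      intro W hW x hx i hi hiA' hiU
      have hx' := mem_filter.1 hx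
      have := hout W hW i hi hiA' hiU
      simp only [Step, not_exists, not_and] at this
      have := this x hx'.1 hx'.2
      simp only [Movable, not_forall, not_not] at this
      obtain ⟨w, hw, hwi, hxw⟩ := this
      exact card_pos.2 ⟨w, mem_filter.2 ⟨mem_filter.2 ⟨hw, hwi⟩, hxw⟩⟩)
    (fun y hy => by have := hdegC y (hBS hy); omega)
    (fun W _ x hx => by have := hdegC x (hPS W hx); omega)
  have hWA := hA' hW
  have hWa : W ≠ a := by
    rintro rfl
    exact haA' hW
  have hz' := mem_filter.1 hz
  have hzA₀ : z ∈ A₀ := mem_filter.2 ⟨hz'.1, by rw [hz'.2]; exact hWA⟩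
  have hyA₀ : y ∉ A₀ := fun h => disjoint_left.1 hdisj h hy
  have hzB : z ∉ B := fun h => disjoint_left.1 hdisj hzA₀ h
  have hzy : z ≠ y := by
    rintro rfl
    exact hzB hy
  have hyA₀z : y ∉ A₀.erase z := fun h => hyA₀ (mem_of_mem_erase h)
  have huniq : ∀ y', {x ∈ P W | G.Adj y' x} = {z} → ∀ w ∈ A₀.erase z, c w = W →
      ¬ G.Adj y' w := by
    intro y' hy' w hw hwW hadj
    have hw' := mem_erase.1 hw
    have : w ∈ ({x ∈ P W | G.Adj y' x} : Finset V) :=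
      mem_filter.2 ⟨mem_filter.2 ⟨hA₀S w hw'.2, hwW⟩, hadj⟩
    rw [hy', mem_singleton] at this
    exact hw'.1 this
  -- recolor `B` without `y` by induction
  obtain ⟨g, hg⟩ := ih (C \ A) (sdiff_ssubset hAC ⟨a, haA⟩) (B.erase y)
    ((erase_subset _ _).trans hBS) (by rw [card_erase_of_mem hy, hBcard, Nat.add_sub_cancel])
    (by
      intro v hv
      have hvB := mem_of_mem_erase hv
      have h1 := hdegC v (hBS hvB)
      have h2 : #A ≤ ∑ i ∈ A, #{x ∈ P i | G.Adj v x} := by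
        rw [card_eq_sum_ones]
        exact sum_le_sum fun i hi => hBA v hvB i hi
      have h3 : #{w ∈ B.erase y | G.Adj v w} ≤ #{w ∈ B | G.Adj v w} :=
        card_le_card (filter_subset_filter _ (erase_subset _ _))
      omega)
  -- exchange `z` for `y` in the class `W`
  set c₁ : V → ι := Function.update c y W with hc₁
  have hc₁y : c₁ y = W := Function.update_self _ _ _
  have hc₁v : ∀ v ∈ A₀, c₁ v = c v := fun v hv =>
    Function.update_of_ne (by rintro rfl; exact hyA₀ hv) _ _
  have hprop₀ : IsProperOn G A₀ A c :=
    ⟨hA₀A, fun v hv w hw => h.ne v (hA₀S v hv) w (hA₀S w hw)⟩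
  have hprop₁ : IsProperOn G (insert y (A₀.erase z)) A c₁ :=
    (hprop₀.subset (erase_subset _ _)).insert hyA₀z hWA (huniq y hyz)
  have hcard₁ : ∀ i ∈ A,
      (#{v ∈ insert y (A₀.erase z) | c₁ v = i} + if i = a then 1 else 0) = s := by
    intro i hi
    rw [← h.card i (hAC hi), hc₁, card_filter_update hyA₀z]
    congr 1
    have e : ({v ∈ S.erase u | c v = i} : Finset V) = {v ∈ insert z (A₀.erase z) | c v = i} := by
      rw [insert_erase hzA₀]
      ext v
      simp only [A₀, mem_filter]
      constructor
      · rintro ⟨hv, rfl⟩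
        exact ⟨⟨hv, hi⟩, rfl⟩
      · tauto
    rw [e, filter_insert]
    by_cases hiW : i = W
    · rw [if_pos hiW, if_pos (hz'.2.trans hiW.symm), card_insert_of_notMem (by simp)]
    · rw [if_neg hiW, if_neg (fun e => hiW (e.symm.trans hz'.2)), add_zero]
  have hdisjC : Disjoint A (C \ A) := disjoint_sdiff
  by_cases hX : ∃ X ∈ A, X ≠ W ∧ ∀ w ∈ P X, ¬ G.Adj z w
  · left
    obtain ⟨X, hXA, hXW, hzX⟩ := hX
    have hmv : ∀ v j, j ∈ A.erase W → Movable G (S.erase u) c v j →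
        Movable G (insert y (A₀.erase z)) c₁ v j := by
      intro v j hj hm w hw hwj
      rcases mem_insert.1 hw with rfl | hw
      · exact absurd (hwj.symm.trans hc₁y) (mem_erase.1 hj).1
      · have hw' := mem_of_mem_erase hw
        exact hm w (hA₀S w hw') ((hc₁v w hw').symm.trans hwj)
    obtain ⟨c₂, hc₂, hcard₂⟩ := exists_insert (G := G) (C := A) (a := a) (A.erase W)
      (insert y (A₀.erase z)) c₁ z X (erase_subset _ _) hXA (by simp [hzy]) hprop₁
      (hmv z X (mem_erase.2 ⟨hXW, hXA⟩) fun w hw hwX => hzX w (mem_filter.2 ⟨hw, hwX⟩))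
      ((hterm W hW X hXA hXW).mono subset_rfl (by
        rintro i hi j hj ⟨v, hv, hvi, hvm⟩
        have hvA : v ∈ A₀ := mem_filter.2 ⟨hv, hvi ▸ mem_of_mem_erase hi⟩
        have hvz : v ≠ z := by
          rintro rfl
          exact (mem_erase.1 hi).1 (hvi.symm.trans hz'.2)
        exact ⟨v, mem_insert_of_mem (mem_erase.2 ⟨hvz, hvA⟩), (hc₁v v hvA).trans hvi,
          hmv v j hj hvm⟩))
    rw [Finset.insert_comm, insert_erase hzA₀] at hc₂ hcard₂
    obtain ⟨c₃, -, -, hc₃, hcardA, hcardB⟩ := hc₂.exists_union hg.toIsProperOn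
      (by
        refine disjoint_left.2 fun v hv hvB => ?_
        rcases mem_insert.1 hv with rfl | hv
        · exact notMem_erase _ _ hvB
        · exact disjoint_left.1 hdisj hv (mem_of_mem_erase hvB)) hdisjC
    have hS : insert y A₀ ∪ B.erase y = S := by
      rw [insert_union, ← union_insert, insert_erase hy, hunion]
    rw [hS] at hc₃ hcardA hcardB
    rw [union_sdiff_of_subset hAC] at hc₃
    refine ⟨c₃, hc₃, fun i hi => ?_⟩
    by_cases hiA : i ∈ A
    · rw [hcardA i hiA, hcard₂, hcard₁ i hiA]
    · have hi' := mem_sdiff.2 ⟨hi, hiA⟩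
      rw [hcardB i hi', hg.card i hi']
  · right
    rcases hcase with hcase | ⟨y', hy', hyy', hyz', hnadj⟩
    · exact absurd hcase hX
    obtain ⟨c₂, hc₂A, hc₂B, hc₂, hcardA, hcardB⟩ := hprop₁.exists_union hg.toIsProperOn
      (by
        refine disjoint_left.2 fun v hv hvB => ?_
        rcases mem_insert.1 hv with rfl | hv
        · exact notMem_erase _ _ hvB
        · exact disjoint_left.1 hdisj (mem_of_mem_erase hv) (mem_of_mem_erase hvB)) hdisjC
    have hS : insert y (A₀.erase z) ∪ B.erase y = S.erase z := by
      rw [insert_union, ← union_insert, insert_erase hy, ← hunion, erase_union_distrib,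
        erase_eq_of_notMem hzB]
    rw [hS] at hc₂ hcardA hcardB
    rw [union_sdiff_of_subset hAC] at hc₂
    have hnear : IsNearEquitable G S C s a z c₂ := by
      refine ⟨hc₂, mem_of_mem_erase hz'.1, fun i hi => ?_⟩
      by_cases hiA : i ∈ A
      · rw [hcardA i hiA, hcard₁ i hiA]
      · have hi' := mem_sdiff.2 ⟨hi, hiA⟩
        rw [hcardB i hi', hg.card i hi', if_neg (by rintro rfl; exact hiA haA), add_zero]
    have hclass : ∀ w ∈ S.erase z, c₂ w ∈ A →
        w = y ∧ c₂ w = W ∨ w ∈ A₀.erase z ∧ c₂ w = c w := by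
      intro w hw hwA
      rw [← hS, mem_union] at hw
      rcases hw with hw | hw
      · rw [hc₂A w hw]
        rcases mem_insert.1 hw with rfl | hw
        · exact Or.inl ⟨rfl, hc₁y⟩
        · exact Or.inr ⟨hw, hc₁v w (mem_of_mem_erase hw)⟩
      · rw [hc₂B w hw] at hwA
        exact absurd (hg.mem w hw) (disjoint_left.1 hdisjC hwA)
    have hstep : ∀ v ∈ A₀.erase z, ∀ j ∈ A.erase W, Movable G (S.erase u) c v j →
        Step G (S.erase z) c₂ (c v) j := by
      intro v hv j hj hm
      have hv₁ : v ∈ insert y (A₀.erase z) := mem_insert_of_mem hv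
      refine ⟨v, hS ▸ mem_union_left _ hv₁,
        (hc₂A v hv₁).trans (hc₁v v (mem_of_mem_erase hv)), fun w hw hwj => ?_⟩
      rcases hclass w hw (hwj ▸ mem_of_mem_erase hj) with ⟨-, e⟩ | ⟨hwA, e⟩
      · exact absurd (hwj.symm.trans e) (mem_erase.1 hj).1
      · exact hm w (hA₀S w (mem_of_mem_erase hwA)) (e.symm.trans hwj)
    have hreach : ∀ X ∈ A.erase W, ReachIn (Step G (S.erase z) c₂) C a X := by
      intro X hXA
      refine (hterm W hW X (mem_of_mem_erase hXA) (mem_erase.1 hXA).1).mono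
        ((erase_subset _ _).trans hAC) ?_
      rintro i hi j hj ⟨v, hv, rfl, hvm⟩
      refine hstep v (mem_erase.2 ⟨?_, mem_filter.2 ⟨hv, mem_of_mem_erase hi⟩⟩) j hj hvm
      rintro rfl
      exact (mem_erase.1 hi).1 hz'.2
    have hreachW : ReachIn (Step G (S.erase z) c₂) C a W := by
      obtain ⟨j, hj, ⟨v, hv, hvW, hvm⟩, -⟩ := (hAreach W hWA).exists_step hWa
      refine (hreach j hj).head (hAC hWA) (hAC (mem_of_mem_erase hj)) ?_
      rw [← hvW]
      refine hstep v (mem_erase.2 ⟨?_, mem_filter.2 ⟨hv, hvW ▸ hWA⟩⟩) j hj hvm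
      rintro rfl
      exact hX ⟨j, mem_of_mem_erase hj, (mem_erase.1 hj).1, fun w hw =>
        hvm w (mem_filter.1 hw).1 (mem_filter.1 hw).2⟩
    refine ⟨z, c₂, hnear, (ssubset_iff_of_subset fun X hXA => ?_).2 ⟨g y', ?_, ?_⟩⟩
    · refine mem_filter.2 ⟨hAC hXA, ?_⟩
      by_cases hXW : X = W
      · exact hXW ▸ hreachW
      · exact hreach X (mem_erase.2 ⟨hXW, hXA⟩)
    · have hy'B : y' ∈ B.erase y := mem_erase.2 ⟨hyy', hy'⟩
      have hgC := (mem_sdiff.1 (hg.mem y' hy'B)).1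
      refine mem_filter.2 ⟨hgC, hreachW.head hgC (hAC hWA)
        ⟨y', hS ▸ mem_union_right _ hy'B, hc₂B y' hy'B, fun w hw hwW => ?_⟩⟩
      rcases hclass w hw (hwW ▸ hWA) with ⟨rfl, -⟩ | ⟨hwA, e⟩
      · exact fun e => hnadj e.symm
      · exact huniq y' hyz' w hwA (e.symm.trans hwW)
    · exact (mem_sdiff.1 (hg.mem y' (mem_erase.2 ⟨hyy', hy'⟩))).2

lemma IsNearEquitable.exists_equitable {G : SimpleGraph V} {S : Finset V}
    {C : Finset ι} {s : ℕ} {a : ι} (ha : a ∈ C)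
    (hdeg : ∀ v ∈ S, #{w ∈ S | G.Adj v w} < #C)
    (ih : ∀ C' ⊂ C, ∀ S' ⊆ S, #S' = s * #C' → (∀ v ∈ S', #{w ∈ S' | G.Adj v w} < #C') →
      ∃ c' : V → ι, IsEquitableOn G S' C' s c')
    {u : V} {c : V → ι} (h : IsNearEquitable G S C s a u c) :
    ∃ c' : V → ι, IsEquitableOn G S C s c' := by
  induction hn : #C - #(accessible G (S.erase u) C a c) using Nat.strong_induction_on
    generalizing u c with
  | _ n ihn =>
  rcases h.exists_equitable_or_improve ha hdeg ih with h' | ⟨u', c', h', hlt⟩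
  · exact h'
  · have h1 := card_lt_card hlt
    have h2 : #(accessible G (S.erase u') C a c') ≤ #C := card_le_card (filter_subset _ _)
    exact ihn _ (by omega) h' rfl

/-- The graph of all edges of `G` with both ends in `U`. -/
def edgesWithin (G : SimpleGraph V) (U : Finset V) : SimpleGraph V where
  Adj v w := G.Adj v w ∧ v ∈ U ∧ w ∈ U
  symm := ⟨fun _ _ h => ⟨h.1.symm, h.2.2, h.2.1⟩⟩
  loopless := ⟨fun _ h => G.irrefl h.1⟩

lemma exists_equitable_of_no_edges [Nonempty ι] {G : SimpleGraph V} (hG : ∀ v w, ¬ G.Adj v w)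
    (s : ℕ) (C : Finset ι) :
    ∀ S : Finset V, #S = s * #C → ∃ c : V → ι, IsEquitableOn G S C s c := by
  induction C using Finset.induction_on with
  | empty =>
    intro S hS
    have : S = ∅ := by simpa using hS
    subst this
    exact ⟨fun _ => Classical.arbitrary ι, ⟨by simp, by simp⟩, by simp⟩
  | insert i C hi ih =>
    intro S hS
    rw [card_insert_of_notMem hi, mul_add, mul_one] at hS
    obtain ⟨S₁, hS₁, hcard⟩ := exists_subset_card_eq (s := S) (n := s) (by omega)
    obtain ⟨c, hc⟩ := ih (S \ S₁) (by rw [card_sdiff_of_subset hS₁]; omega)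
    have h₁ : IsProperOn G S₁ {i} fun _ => i :=
      ⟨fun _ _ => mem_singleton_self i, fun v _ w _ h => absurd h (hG v w)⟩
    obtain ⟨c', -, -, hc', hcard₁, hcard₂⟩ := h₁.exists_union hc.toIsProperOn disjoint_sdiff
      (disjoint_singleton_left.2 hi)
    rw [union_sdiff_of_subset hS₁] at hc' hcard₁ hcard₂
    refine ⟨c', insert_eq i C ▸ hc', fun j hj => ?_⟩
    rcases mem_insert.1 hj with rfl | hj
    · rw [hcard₁ j (mem_singleton_self j)]
      simpa using hcard
    · rw [hcard₂ j hj, hc.card j hj]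

theorem exists_equitable [Nonempty ι] (G : SimpleGraph V) (s : ℕ) (C : Finset ι) :
    ∀ S : Finset V, #S = s * #C → (∀ v ∈ S, #{w ∈ S | G.Adj v w} < #C) →
      ∃ c : V → ι, IsEquitableOn G S C s c := by
  induction C using Finset.strongInduction generalizing G with
  | H C ih =>
  intro S hS hdeg
  have key : ∀ U : Finset V, ∃ c : V → ι, IsEquitableOn (edgesWithin G U) S C s c := by
    intro U
    induction U using Finset.induction_on with
    | empty =>
      exact exists_equitable_of_no_edges (G := edgesWithin G ∅)
        (fun v _ h => notMem_empty v h.2.1) s C S hS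
    | insert x U _ ihU =>
      obtain ⟨c, hc⟩ := ihU
      have hproper : IsProperOn (edgesWithin G (insert x U)) (S.erase x) C c := by
        refine ⟨fun v hv => hc.mem v (mem_of_mem_erase hv), fun v hv w hw hvw => ?_⟩
        have hv' := mem_erase.1 hv
        have hw' := mem_erase.1 hw
        exact hc.ne v hv'.2 w hw'.2 ⟨hvw.1, mem_of_mem_insert_of_ne hvw.2.1 hv'.1,
          mem_of_mem_insert_of_ne hvw.2.2 hw'.1⟩
      by_cases hx : x ∈ S
      · refine IsNearEquitable.exists_equitable (a := c x) (u := x) (c := c) (hc.mem x hx) ?_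
          (fun C' hC' S' _ => ih C' hC' _ S') ⟨hproper, hx, fun i hi => ?_⟩
        · intro v hv
          refine lt_of_le_of_lt (card_le_card fun w hw => ?_) (hdeg v hv)
          have hw' := mem_filter.1 hw
          exact mem_filter.2 ⟨hw'.1, hw'.2.1⟩
        · rw [← hc.card i hi]
          conv_rhs => rw [← insert_erase hx, filter_insert]
          by_cases hi' : i = c x
          · rw [if_pos hi', if_pos hi'.symm, card_insert_of_notMem (by simp)]
          · rw [if_neg hi', if_neg (fun e => hi' e.symm), add_zero]
      · rw [erase_eq_of_notMem hx] at hproper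
        exact ⟨c, hproper, hc.card⟩
  obtain ⟨c, hc⟩ := key S
  exact ⟨c, ⟨hc.mem, fun v hv w hw hvw => hc.ne v hv w hw ⟨hvw, hv, hw⟩⟩, hc.card⟩

lemma exists_equitable_fin {V : Type*} [Fintype V] (G : SimpleGraph V) (s k : ℕ) (hk : 0 < k)
    (hcard : Fintype.card V = s * k) (hdeg : ∀ v, #{w | G.Adj v w} < k) :
    ∃ c : V → Fin k, (∀ v w, G.Adj v w → c v ≠ c w) ∧ ∀ i, #{v | c v = i} = s := by
  have : Nonempty (Fin k) := ⟨⟨0, hk⟩⟩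
  obtain ⟨c, hc⟩ := exists_equitable G s (univ : Finset (Fin k)) univ (by simpa using hcard)
    (by simpa using hdeg)
  exact ⟨c, fun v w => hc.ne v (mem_univ v) w (mem_univ w),
    fun i => by convert hc.card i (mem_univ i)⟩

end HajnalSzemeredi

/-- The Hajnal–Szemerédi theorem: every graph on `N` vertices with maximum degree at most
`k-1` has an equitable proper coloring with `k` colors (any two color classes differ in
size by at most 1); in particular, if `k ∣ N` and the maximum degree is less than `N/k`,
then `G` has `N/k` pairwise disjoint independent sets of size `k` covering all vertices. -/
theorem hajnal_szemeredi :
    (∀ (V : Type) [Fintype V] [DecidableEq V] (G : SimpleGraph V) (k : ℕ), 0 < k →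
      (∀ v : V, G.degree v ≤ k - 1) →
      ∃ c : V → Fin k,
        (∀ v w : V, G.Adj v w → c v ≠ c w) ∧
        (∀ i j : Fin k,
          (Finset.univ.filter (fun v => c v = i)).card ≤
            (Finset.univ.filter (fun v => c v = j)).card + 1)) ∧
    (∀ (V : Type) [Fintype V] [DecidableEq V] (G : SimpleGraph V) (k : ℕ), 0 < k →
      k ∣ Fintype.card V →
      (∀ v : V, G.degree v < Fintype.card V / k) →
      ∃ P : Finset (Finset V),
        P.card = Fintype.card V / k ∧
        (∀ S ∈ P, S.card = k ∧ ∀ v ∈ S, ∀ w ∈ S, ¬ G.Adj v w) ∧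
        (∀ S ∈ P, ∀ T ∈ P, S ≠ T → Disjoint S T) ∧
        (∀ v : V, ∃ S ∈ P, v ∈ S)) := by
  constructor
  · intro V _ _ G k hk hdeg
    set N := Fintype.card V with hN
    -- add a disjoint clique to make the number of vertices a multiple of `k`
    have hlt := Nat.lt_mul_div_succ N hk
    have hle := Nat.mul_div_le N k
    rw [mul_add, mul_one] at hlt
    set s := N / k + 1 with hs
    have hsk : s * k = k * (N / k) + k := by rw [hs]; ring
    let p := s * k - N
    obtain ⟨c, hc, hcard⟩ := HajnalSzemeredi.exists_equitable_fin
      (G ⊕g (⊤ : SimpleGraph (Fin p))) s k hk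
      (by rw [Fintype.card_sum, Fintype.card_fin, ← hN]; omega)
      (by
        rintro (v | j)
        · have := hdeg v
          rw [← G.card_neighborFinset_eq_degree, G.neighborFinset_eq_filter] at this
          rw [card_filter, Fintype.sum_sum_type]
          simp only [SimpleGraph.sum_adj_inl, SimpleGraph.not_adj_sum_inl_inr, if_false,
            sum_const_zero, add_zero, ← card_filter]
          omega
        · rw [card_filter, Fintype.sum_sum_type]
          simp only [SimpleGraph.adj_comm _ (Sum.inr j) (Sum.inl _),
            SimpleGraph.not_adj_sum_inl_inr, if_false, sum_const_zero, zero_add, ← card_filter]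
          have h1 : #{j' | (G ⊕g (⊤ : SimpleGraph (Fin p))).Adj (Sum.inr j) (Sum.inr j')} <
              #(univ : Finset (Fin p)) :=
            card_lt_card ((ssubset_iff_of_subset (filter_subset _ _)).2 ⟨j, by simp⟩)
          rw [card_univ, Fintype.card_fin] at h1
          omega)
    refine ⟨fun v => c (Sum.inl v), fun v w h => hc _ _ (by simpa using h), ?_⟩
    have hsum : ∀ i, #{v | c (Sum.inl v) = i} + #{j | c (Sum.inr j) = i} = s := by
      intro i
      rw [← hcard i]
      simp only [card_filter, Fintype.sum_sum_type]
    have hone : ∀ i, #{j | c (Sum.inr j) = i} ≤ 1 := by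
      intro i
      refine card_le_one.2 fun j hj j' hj' => ?_
      by_contra hne
      exact hc (Sum.inr j) (Sum.inr j') (by simpa using hne)
        ((mem_filter.1 hj).2.trans (mem_filter.1 hj').2.symm)
    intro i j
    have h1 := hsum i
    have h2 := hsum j
    have h3 := hone j
    dsimp only
    omega
  · intro V _ _ G k hk hdvd hdeg
    rcases Nat.eq_zero_or_pos (Fintype.card V / k) with h0 | hpos
    · exact ⟨∅, by simp [h0], by simp, by simp, fun v => absurd (hdeg v) (by simp [h0])⟩
    obtain ⟨c, hc, hcard⟩ := HajnalSzemeredi.exists_equitable_fin G k (Fintype.card V / k) hpos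
      (Nat.mul_div_cancel' hdvd).symm
      (by
        intro v
        have := hdeg v
        rw [← G.card_neighborFinset_eq_degree, G.neighborFinset_eq_filter] at this
        convert this)
    have hinj : Function.Injective fun i => ({v | c v = i} : Finset V) := by
      intro i j hij
      obtain ⟨v, hv⟩ := card_pos.1 (by rw [hcard i]; exact hk)
      have hv' : v ∈ ({v | c v = j} : Finset V) := (Finset.ext_iff.1 hij v).1 hv
      exact (mem_filter.1 hv).2.symm.trans (mem_filter.1 hv').2
    refine ⟨univ.image fun i => ({v | c v = i} : Finset V), ?_, ?_, ?_, ?_⟩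
    · rw [card_image_of_injective _ hinj, card_univ, Fintype.card_fin]
    · intro S hS
      obtain ⟨i, -, rfl⟩ := mem_image.1 hS
      exact ⟨hcard i, fun v hv w hw h =>
        hc v w h ((mem_filter.1 hv).2.trans (mem_filter.1 hw).2.symm)⟩
    · intro S hS T hT hST
      obtain ⟨i, -, rfl⟩ := mem_image.1 hS
      obtain ⟨j, -, rfl⟩ := mem_image.1 hT
      refine disjoint_left.2 fun v hv hw => hST ?_
      rw [← (mem_filter.1 hv).2, (mem_filter.1 hw).2]
    · exact fun v => ⟨_, mem_image_of_mem _ (mem_univ (c v)), by simp⟩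
end

section
/- Fix k > r ≥ 3. The balanced complete k-partite r-graph T_r(n,k) satisfies H(T_r(n,k)) ≥ (1/2)·((k-r+1)/k)^n·(n-1)!·(k-r+1)^{-Θ(√n)} for all sufficiently large n. -/
open Finset

/-- The "r-set" of a permutation `π` of `ZMod n`: the set of `n` edges of the Hamiltonian
cycle of `K_n^r` corresponding to `π`. -/
def rset (n r : ℕ) [NeZero n] (π : Equiv.Perm (ZMod n)) : Finset (Finset (ZMod n)) :=
  Finset.image (fun i : ZMod n =>
    Finset.image (fun j : Fin r => π (i + (j.val : ZMod n))) Finset.univ) Finset.univ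

/-- The set of Hamiltonian cycles of the `r`-graph with edge set `G` on `ZMod n`, each
Hamiltonian cycle identified with its set of `n` edges. -/
def hamCycles (n r : ℕ) [NeZero n] (G : Finset (Finset (ZMod n))) :
    Finset (Finset (Finset (ZMod n))) :=
  Finset.image (rset n r)
    (Finset.univ.filter (fun π : Equiv.Perm (ZMod n) => rset n r π ⊆ G))

/-- `Hmax n r m` : the maximum number of Hamiltonian cycles over all `r`-graphs on `n`
vertices with exactly `m` edges. -/
def Hmax (n r m : ℕ) [NeZero n] : ℕ :=
  Finset.sup (((Finset.univ : Finset (ZMod n)).powersetCard r).powersetCard m)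
    (fun G => (hamCycles n r G).card)

/-- The balanced complete `k`-partite `r`-graph `T_r(n,k)` on vertex set `ZMod n`, whose
parts are the residue classes modulo `k` (so all parts have size `⌊n/k⌋` or `⌈n/k⌉`):
its edges are the `r`-subsets meeting each part at most once. -/
def TEdges (n k r : ℕ) [NeZero n] : Finset (Finset (ZMod n)) :=
  ((Finset.univ : Finset (ZMod n)).powersetCard r).filter
    (fun e => ∀ a ∈ e, ∀ b ∈ e, a ≠ b → a.val % k ≠ b.val % k)

/-- Any `s + 1` consecutive letters of the word are distinct. -/
def LocallyNodup {α : Type*} (s : ℕ) : List α → Prop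
  | [] => True
  | x :: w => x ∉ w.take s ∧ LocallyNodup s w

namespace LocallyNodup

variable {α β : Type*} {s : ℕ}

theorem of_nodup : ∀ {w : List α}, w.Nodup → LocallyNodup s w
  | [], _ => trivial
  | x :: w, h => by
    rw [List.nodup_cons] at h
    exact ⟨fun hx => h.1 (List.mem_of_mem_take hx), of_nodup h.2⟩

theorem append {b c : List α} (hb : s ≤ b.length) (hbc : LocallyNodup s (b ++ c)) :
    ∀ {a : List α}, LocallyNodup s (a ++ b) → LocallyNodup s (a ++ (b ++ c))
  | [], _ => hbc
  | x :: a, h => by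
    refine ⟨?_, append hb hbc h.2⟩
    have h1 := h.1
    rw [List.append_eq] at h1 ⊢
    rw [← List.append_assoc, List.take_append_of_le_length (by simp; omega)]
    exact h1

theorem nodup_take : ∀ {w : List α}, LocallyNodup s w → (w.take s).Nodup := by
  suffices H : ∀ (t : ℕ) (w : List α), t ≤ s → LocallyNodup s w → (w.take t).Nodup from
    fun {w} h => H s w le_rfl h
  intro t w
  induction w generalizing t with
  | nil => simp
  | cons x w ih =>
    intro ht h
    cases t with
    | zero => simp
    | succ t =>
      rw [List.take_succ_cons, List.nodup_cons]
      exact ⟨fun hx => h.1 ((List.take_subset_take_left w (by omega)) hx), ih t (by omega) h.2⟩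

theorem map {f : α → β} (hf : Function.Injective f) :
    ∀ {w : List α}, LocallyNodup s w → LocallyNodup s (w.map f)
  | [], _ => trivial
  | x :: w, h => by
    refine ⟨?_, map hf h.2⟩
    rw [← List.map_take, List.mem_map_of_injective hf]
    exact h.1

theorem cons_append {y : α} {c d : List α} (hy : y ∉ c) (hs : s ≤ c.length)
    (h : LocallyNodup s (c ++ d)) : LocallyNodup s (y :: (c ++ d)) := by
  refine ⟨?_, h⟩
  rw [List.take_append_of_le_length hs]
  exact fun hx => hy (List.mem_of_mem_take hx)

theorem repeat_prefix (a : List α) : ∀ {b d : List α}, (a ++ b).Nodup → s + 1 ≤ (a ++ b).length →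
    LocallyNodup s (b ++ (a ++ d)) → LocallyNodup s (a ++ (b ++ (a ++ d))) := by
  induction a using List.reverseRecOn with
  | nil => intro b d _ _ h; simpa using h
  | append_singleton a y ih =>
    intro b d hn hl h
    have hn' : (a ++ (y :: b)).Nodup := by simpa using hn
    have key := ih (b := y :: b) (d := y :: d) hn' (by simpa using hl) (by
      have := cons_append (s := s) (y := y) (c := b ++ a) (d := y :: d) (by
        rw [List.nodup_middle, List.nodup_cons] at hn'
        simp only [List.mem_append] at hn' ⊢
        tauto) (by simp at hl ⊢; omega) (by simpa using h)
      simpa using this)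
    simpa using key

theorem getElem_ne : ∀ {w : List α}, LocallyNodup s w → ∀ {i d : ℕ} (hi : i + d < w.length),
    0 < d → d ≤ s → w[i] ≠ w[i + d]
  | x :: w, h, 0, d + 1, hi, _, hs => by
    intro he
    apply h.1
    simp only [List.getElem_cons_zero, zero_add, List.getElem_cons_succ] at he
    rw [he, List.mem_take_iff_getElem]
    exact ⟨d, by simp at hi ⊢; omega, rfl⟩
  | x :: w, h, i + 1, d, hi, hd, hs => by
    have := getElem_ne h.2 (i := i) (d := d) (by simp at hi; omega) hd hs
    simpa [Nat.add_right_comm i 1 d] using this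

end LocallyNodup

/-- Prepending `w` to the word `p` gives a locally duplicate-free word starting with `q`. -/
def Joins {α : Type*} (s : ℕ) (p w q : List α) : Prop :=
  LocallyNodup s (w ++ p) ∧ q <+: w ++ p

namespace Joins

variable {α β : Type*} {s : ℕ} {p q t w w' : List α}

theorem nil (hp : LocallyNodup s p) : Joins s p [] p := ⟨hp, List.prefix_rfl⟩

theorem trans (hq : s ≤ q.length) (h : Joins s p w q) (h' : Joins s q w' t) :
    Joins s p (w' ++ w) t := by
  obtain ⟨h1, c, hc⟩ := h
  obtain ⟨h2, h3⟩ := h'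
  rw [Joins, List.append_assoc, ← hc]
  refine ⟨LocallyNodup.append hq (hc ▸ h1) h2, h3.trans ?_⟩
  rw [← List.append_assoc]
  exact List.prefix_append _ _

theorem map {f : α → β} (hf : Function.Injective f) (h : Joins s p w q) :
    Joins s (p.map f) (w.map f) (q.map f) := by
  rw [Joins, ← List.map_append]
  exact ⟨h.1.map hf, h.2.map f⟩

theorem move_to_front {a b : List α} {x : α} (hn : (a ++ x :: b).Nodup)
    (hs : s + 2 ≤ (a ++ x :: b).length) :
    Joins s (a ++ x :: b) (x :: (a ++ b)) (x :: (a ++ b)) := by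
  refine ⟨?_, List.prefix_append _ _⟩
  have hab := List.nodup_middle.1 hn
  have hl : s + 1 ≤ (a ++ b).length := by simp at hs ⊢; omega
  have h1 : LocallyNodup s (b ++ ((a ++ [x]) ++ (b ++ []))) := by
    refine LocallyNodup.repeat_prefix b ?_ (by simp at hs ⊢; omega)
      (LocallyNodup.of_nodup (by simpa using hn))
    rw [List.nodup_append_comm]
    simpa using hn
  have h1' : LocallyNodup s (b ++ (a ++ (x :: b))) := by simpa using h1
  have h2 : LocallyNodup s (a ++ (b ++ (a ++ (x :: b)))) :=
    LocallyNodup.repeat_prefix a (List.nodup_cons.1 hab).2 hl h1'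
  have h3 := LocallyNodup.cons_append (s := s) (y := x) (c := a ++ b) (d := a ++ x :: b)
    (List.nodup_cons.1 hab).1 (by omega) (by rw [List.append_assoc]; exact h2)
  simpa using h3

theorem exists_of_append_perm [DecidableEq α] (hp : p.Nodup) (hs : s + 2 ≤ p.length) :
    ∀ q : List α, q.Nodup → q ⊆ p → ∃ w rest, Joins s p w (q ++ rest) ∧ (q ++ rest).Perm p ∧
      w.length = q.length * p.length ∧ ∀ x, w.count x = q.length * p.count x
  | [], _, _ => ⟨[], p, nil (.of_nodup hp), by simp, by simp, by simp⟩
  | y :: q, hq, hqp => by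
    obtain ⟨w, rest, h1, h2, h3, h4⟩ := exists_of_append_perm hp hs q (List.nodup_cons.1 hq).2
      fun z hz => hqp (List.mem_cons_of_mem _ hz)
    have hy : y ∈ rest := by
      have : y ∈ q ++ rest := h2.mem_iff.2 (hqp List.mem_cons_self)
      exact (List.mem_append.1 this).resolve_left (List.nodup_cons.1 hq).1
    obtain ⟨c, d, rfl⟩ := List.append_of_mem hy
    have hn := h2.nodup_iff.2 hp
    have hP : (y :: (q ++ (c ++ d))).Perm p := by
      refine List.Perm.trans ?_ h2
      simpa using (List.perm_middle (l₁ := q ++ c) (a := y) (l₂ := d)).symm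
    refine ⟨y :: (q ++ (c ++ d)) ++ w, c ++ d, ?_, by simpa using hP, ?_, ?_⟩
    · refine h1.trans (by rw [h2.length_eq]; omega) ?_
      have := move_to_front (s := s) (a := q ++ c) (b := d) (x := y) (by simpa using hn)
        (by have := h2.length_eq; simp at this ⊢; omega)
      simpa using this
    · rw [List.length_append, hP.length_eq, h3, List.length_cons]; ring
    · intro x
      rw [List.count_append, hP.count_eq, h4, List.length_cons]; ring

theorem exists_of_perm [DecidableEq α] (hp : p.Nodup) (hs : s + 2 ≤ p.length) (hqp : q.Perm p) :
    ∃ w, Joins s p w q ∧ w.length = p.length * p.length ∧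
      ∀ x, w.count x = p.length * p.count x := by
  obtain ⟨w, rest, h1, h2, h3, h4⟩ := exists_of_append_perm hp hs q (hqp.nodup_iff.2 hp) hqp.subset
  have : rest = [] := by
    have := h2.length_eq
    rw [List.length_append, hqp.length_eq] at this
    exact List.length_eq_zero_iff.1 (by omega)
  subst this
  rw [List.append_nil] at h1
  rw [hqp.length_eq] at h3 h4
  exact ⟨w, h1, h3, h4⟩

end Joins

/-- The first letters of a locally duplicate-free word extend to the left by an enumeration of
the alphabet. -/
theorem LocallyNodup.exists_enumeration {α : Type*} [Fintype α] [DecidableEq α] {s : ℕ}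
    (hs : s + 1 ≤ Fintype.card α) {w : List α} (h : LocallyNodup s w) (hw : s ≤ w.length) :
    ∃ p : List α, p.Nodup ∧ p.length = Fintype.card α ∧ LocallyNodup s (p ++ w) := by
  set z := w.take s with hz
  set c := (univ \ z.toFinset : Finset α).toList with hc
  have hzn : z.Nodup := h.nodup_take
  have hn : (z ++ c).Nodup := by
    rw [List.nodup_append]
    refine ⟨hzn, Finset.nodup_toList _, ?_⟩
    rintro a ha b hb rfl
    simp [hc, ha] at hb
  have hl : (z ++ c).length = Fintype.card α := by
    rw [← List.toFinset_card_of_nodup hn, ← Finset.card_univ]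
    congr 1
    ext a
    simp [hc]
  refine ⟨z ++ c, hn, hl, ?_⟩
  have hw' : w = z ++ w.drop s := (List.take_append_drop s w).symm
  have hzl : z.length = s := by simp [hz, hw]
  rw [hw', List.append_assoc]
  refine LocallyNodup.repeat_prefix z hn (by omega) (LocallyNodup.append hzl.ge (hw' ▸ h) ?_)
  exact LocallyNodup.of_nodup (List.nodup_append_comm.1 hn)

theorem exists_locallyNodup_words {α : Type*} [Fintype α] [DecidableEq α] (s : ℕ) {p : List α}
    (hp : LocallyNodup s p) : ∀ m : ℕ, ∃ S : Finset (List α),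
      (∀ u ∈ S, u.length = m ∧ LocallyNodup s (u ++ p)) ∧ (Fintype.card α - s) ^ m ≤ #S
  | 0 => ⟨{[]}, by simpa using hp, by simp⟩
  | m + 1 => by
    obtain ⟨S, hS, hc⟩ := exists_locallyNodup_words s hp m
    let next : List α → Finset α := fun u => univ \ ((u ++ p).take s).toFinset
    refine ⟨(S.sigma next).image (fun t => t.2 :: t.1), ?_, ?_⟩
    · intro u hu
      obtain ⟨⟨w, y⟩, hw, rfl⟩ := Finset.mem_image.1 hu
      rw [Finset.mem_sigma] at hw
      refine ⟨by simp [(hS w hw.1).1], ?_, (hS w hw.1).2⟩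
      simpa [next] using hw.2
    · rw [Finset.card_image_of_injOn, Finset.card_sigma, pow_succ]
      · refine (Nat.mul_le_mul_right _ hc).trans ?_
        rw [← smul_eq_mul]
        refine Finset.card_nsmul_le_sum _ _ _ fun u _ => ?_
        have h1 : #((u ++ p).take s).toFinset ≤ s :=
          (List.toFinset_card_le _).trans (List.length_take_le _ _)
        have h2 := Finset.le_card_sdiff ((u ++ p).take s).toFinset (univ : Finset α)
        rw [Finset.card_univ] at h2
        exact (Nat.sub_le_sub_left h1 _).trans h2
      · rintro ⟨w, y⟩ _ ⟨w', y'⟩ _ h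
        simp only [List.cons.injEq] at h
        obtain ⟨rfl, rfl⟩ := h
        rfl

theorem exists_locallyNodup_words_count {α : Type*} [Fintype α] [DecidableEq α] {s : ℕ}
    (hs : s < Fintype.card α) {p : List α} (hp : LocallyNodup s p) (m : ℕ) :
    ∃ (A : Finset (List α)) (v : α → ℕ), ∑ x, v x = m ∧
      (∀ u ∈ A, u.length = m ∧ LocallyNodup s (u ++ p) ∧ ∀ x, u.count x = v x) ∧
      (Fintype.card α - s) ^ m ≤ (m + 1) ^ Fintype.card α * #A := by
  obtain ⟨S, hS, hc⟩ := exists_locallyNodup_words s hp m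
  have hpos : 0 < (Fintype.card α - s) ^ m := pow_pos (by omega) _
  let f : List α → α → ℕ := fun u x => u.count x
  let T : Finset (α → ℕ) := Fintype.piFinset fun _ => Finset.range (m + 1)
  have hT : #T = (m + 1) ^ Fintype.card α := by simp [T]
  have hmaps : ∀ u ∈ S, f u ∈ T := by
    intro u hu
    simp only [T, f, Fintype.mem_piFinset, Finset.mem_range]
    intro x
    have := List.count_le_length (a := x) (l := u)
    rw [(hS u hu).1] at this
    omega
  obtain ⟨v, -, hv⟩ : ∃ v ∈ T, #S ≤ #T * #{u ∈ S | f u = v} := by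
    by_contra! hcon
    have h1 : #T * #S < #T * #S := by
      calc #T * #S = ∑ v ∈ T, #T * #{u ∈ S | f u = v} := by
            rw [← Finset.mul_sum, ← Finset.card_eq_sum_card_fiberwise hmaps]
        _ < ∑ v ∈ T, #S := Finset.sum_lt_sum_of_nonempty
            (Finset.card_pos.1 (by rw [hT]; positivity)) hcon
        _ = #T * #S := by simp
    exact lt_irrefl _ h1
  have hA : ({u ∈ S | f u = v} : Finset _).Nonempty := by
    rw [← Finset.card_pos]
    exact Nat.pos_of_mul_pos_left (hpos.trans_le (hc.trans hv))
  refine ⟨{u ∈ S | f u = v}, v, ?_, ?_, by rw [← hT]; exact hc.trans hv⟩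
  · obtain ⟨u, hu⟩ := hA
    rw [Finset.mem_filter] at hu
    rw [← hu.2, ← (hS u hu.1).1]
    simpa [f] using Multiset.sum_count_eq_card (m := (u : Multiset α)) (s := univ) (fun _ _ => mem_univ _)
  · intro u hu
    rw [Finset.mem_filter] at hu
    exact ⟨(hS u hu.1).1, (hS u hu.1).2, fun x => congrFun hu.2 x⟩

/-- The word `j, j + 1, …, j + l - 1` of residues modulo `k`. -/
def cyc (k j l : ℕ) : List (ZMod k) := (List.range' j l).map Nat.cast

namespace cyc

variable {k : ℕ}

@[simp] theorem length_eq (j l : ℕ) : (cyc k j l).length = l := by simp [cyc]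

theorem locallyNodup {s : ℕ} (hs : s < k) (j l : ℕ) : LocallyNodup s (cyc k j l) := by
  induction l generalizing j with
  | zero => trivial
  | succ l ih =>
    refine ⟨?_, ih (j + 1)⟩
    intro h
    obtain ⟨d, hd, he⟩ := List.mem_take_iff_getElem.1 h
    have hd' := hd
    simp only [lt_inf_iff] at hd'
    simp only [List.getElem_map, List.getElem_range'] at he
    rw [ZMod.natCast_eq_natCast_iff, Nat.ModEq.comm, Nat.modEq_iff_dvd' (by omega)] at he
    exact absurd (Nat.le_of_dvd (by omega) he) (by omega)

theorem nodup (j : ℕ) : (cyc k j k).Nodup := by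
  cases k with
  | zero => simp [cyc]
  | succ k =>
    have h := (locallyNodup (s := k) (Nat.lt_succ_self k) (j + 1) k).nodup_take
    rw [List.take_of_length_le (by simp)] at h
    have h' := (locallyNodup (s := k) (Nat.lt_succ_self k) j (k + 1)).1
    rw [List.take_of_length_le (by simp)] at h'
    exact List.nodup_cons.2 ⟨h', h⟩

theorem count_eq_one [NeZero k] (j : ℕ) (x : ZMod k) : (cyc k j k).count x = 1 := by
  refine List.count_eq_one_of_mem (nodup j) ?_
  have h : (cyc k j k).toFinset = univ := by
    rw [← Finset.card_eq_iff_eq_univ, List.toFinset_card_of_nodup (nodup j), length_eq, ZMod.card]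
  rw [← List.mem_toFinset, h]
  exact mem_univ x

theorem perm [NeZero k] (i j : ℕ) : (cyc k i k).Perm (cyc k j k) :=
  List.perm_iff_count.2 fun x => by rw [count_eq_one, count_eq_one]

theorem map_add (i j l : ℕ) : (cyc k j l).map (· + (i : ZMod k)) = cyc k (j + i) l := by
  rw [cyc, cyc, List.map_map, ← Nat.add_comm i j, ← List.map_add_range', List.map_map]
  refine List.map_congr_left fun x _ => ?_
  simp [add_comm]

theorem self_eq (l : ℕ) : cyc k k l = cyc k 0 l := by
  have := map_add (k := k) k 0 l
  simpa using this.symm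

theorem append (j l l' : ℕ) : cyc k j l ++ cyc k (j + l) l' = cyc k j (l + l') := by
  rw [cyc, cyc, cyc, ← List.map_append, List.range'_append_1]

theorem count_mul_add [NeZero k] (x : ZMod k) (M a : ℕ) :
    (cyc k 0 (k * M + a)).count x = M + (cyc k 0 a).count x := by
  induction M with
  | zero => simp
  | succ M ih =>
    rw [show k * (M + 1) + a = k + (k * M + a) by ring, ← append, zero_add, self_eq,
      List.count_append, ih, count_eq_one]
    ring

theorem joins_extra {s a : ℕ} (hs : s < k) :
    Joins s (cyc k a k) (cyc k 0 a) (cyc k 0 k) := by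
  have h := append (k := k) 0 a k
  rw [zero_add] at h
  rw [Joins, h]
  refine ⟨locallyNodup hs 0 _, ?_⟩
  rw [add_comm, ← append]
  exact List.prefix_append _ _

end cyc

section Blocks

variable {k s : ℕ} [NeZero k]

theorem exists_joins_block (hs : s + 2 ≤ k) {u : List (ZMod k)}
    (hu : LocallyNodup s (u ++ cyc k 0 k)) :
    ∃ t, Joins s (cyc k 0 k) (t ++ u) (cyc k 1 k) ∧ t.length = k * k + k ∧
      ∀ x, t.count x = k + 1 := by
  obtain ⟨p, hp, hpl, hpu⟩ := hu.exists_enumeration (by rw [ZMod.card]; omega) (by simp; omega)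
  rw [ZMod.card] at hpl
  have hmem : ∀ x, x ∈ p := by
    have h : p.toFinset = univ := by
      rw [← Finset.card_eq_iff_eq_univ, List.toFinset_card_of_nodup hp, hpl, ZMod.card]
    intro x
    rw [← List.mem_toFinset, h]
    exact mem_univ x
  have hcount : ∀ x, p.count x = 1 := fun x => List.count_eq_one_of_mem hp (hmem x)
  have hperm : (cyc k 1 k).Perm p :=
    List.perm_iff_count.2 fun x => by rw [cyc.count_eq_one, hcount]
  obtain ⟨w, hw, hwl, hwc⟩ := Joins.exists_of_perm (s := s) hp (by omega) hperm
  refine ⟨w ++ p, ?_, by rw [List.length_append, hwl, hpl], fun x => ?_⟩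
  · have h1 : Joins s (cyc k 0 k) (p ++ u) p := by
      rw [Joins, List.append_assoc]
      exact ⟨hpu, List.prefix_append _ _⟩
    rw [List.append_assoc]
    exact Joins.trans (q := p) (by omega) h1 hw
  · rw [List.count_append, hwc, hcount, hpl, mul_one]

theorem exists_joins_family (hs : s + 2 ≤ k) {m : ℕ} {A : Finset (List (ZMod k))} {v : ZMod k → ℕ}
    (hA : ∀ u ∈ A, u.length = m ∧ LocallyNodup s (u ++ cyc k 0 k) ∧ ∀ x, u.count x = v x) :
    ∀ j : ℕ, ∃ F : Finset (List (ZMod k)), #A ^ j ≤ #F ∧ ∀ w ∈ F,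
      Joins s (cyc k 0 k) w (cyc k j k) ∧ w.length = j * (m + k * k + k) ∧
      ∀ x, w.count x = ∑ i ∈ range j, v (x - i) + j * (k + 1)
  | 0 => ⟨{[]}, by simp, by simpa using Joins.nil (cyc.locallyNodup (by omega) 0 k)⟩
  | j + 1 => by
    obtain ⟨F, hF, hw⟩ := exists_joins_family hs hA j
    have hblock : ∀ u : List (ZMod k), ∃ t : List (ZMod k), u ∈ A →
        Joins s (cyc k 0 k) (t ++ u) (cyc k 1 k) ∧ t.length = k * k + k ∧
          ∀ x, t.count x = k + 1 := by
      intro u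
      by_cases hu : u ∈ A
      · obtain ⟨t, ht⟩ := exists_joins_block hs (hA u hu).2.1
        exact ⟨t, fun _ => ht⟩
      · exact ⟨[], fun h => absurd h hu⟩
    choose t ht using hblock
    have hinj : Function.Injective (fun x : ZMod k => x + (j : ZMod k)) := add_left_injective _
    refine ⟨(A ×ˢ F).image fun z => (t z.1 ++ z.1).map (· + (j : ZMod k)) ++ z.2, ?_, ?_⟩
    · rw [Finset.card_image_of_injOn, Finset.card_product, pow_succ, mul_comm]
      · exact Nat.mul_le_mul_left _ hF
      · rintro ⟨u, w⟩ h ⟨u', w'⟩ h' he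
        simp only [coe_product, Set.mem_prod, mem_coe] at h h'
        obtain ⟨h1, h2⟩ := List.append_inj' he (by rw [(hw w h.2).2.1, (hw w' h'.2).2.1])
        have h3 := (List.append_inj' (hinj.list_map h1)
          (by rw [(hA u h.1).1, (hA u' h'.1).1])).2
        exact Prod.ext h3 h2
    · intro y hy
      obtain ⟨⟨u, w⟩, hz, rfl⟩ := Finset.mem_image.1 hy
      rw [Finset.mem_product] at hz
      obtain ⟨h1, h2, h3⟩ := hw w hz.2
      obtain ⟨h4, h5, h6⟩ := ht u hz.1
      obtain ⟨h7, -, h8⟩ := hA u hz.1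
      refine ⟨?_, ?_, ?_⟩
      · have h9 := h4.map hinj
        rw [cyc.map_add, cyc.map_add, zero_add, add_comm 1 j] at h9
        exact h1.trans (by simp; omega) h9
      · simp only [List.length_append, List.length_map, h2, h5, h7]; ring
      · intro x
        have hx : ∀ l : List (ZMod k), (l.map (· + (j : ZMod k))).count x = l.count (x - j) := by
          intro l
          have := List.count_map_of_injective l _ hinj (x - j)
          simpa using this
        rw [List.count_append, hx, List.count_append, h6, h8, h3, Finset.sum_range_succ]
        ring

/-- Many closed locally duplicate-free words of given length with balanced letter counts. -/
theorem exists_balanced_closed_words (hs : s + 2 ≤ k) (m a : ℕ) :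
    ∃ F : Finset (List (ZMod k)), ((k - s) ^ m) ^ k ≤ ((m + 1) ^ k) ^ k * #F ∧ ∀ w ∈ F,
      Joins s (cyc k 0 k) w (cyc k 0 k) ∧ w.length = k * (m + k * k + 2 * k) + a ∧
      ∀ x, w.count x = (cyc k 0 w.length).count x := by
  obtain ⟨A, v, hv, hA, hc⟩ := exists_locallyNodup_words_count (α := ZMod k) (s := s)
    (by rw [ZMod.card]; omega) (cyc.locallyNodup (by omega) 0 k) m
  rw [ZMod.card] at hc
  obtain ⟨F, hF, hw⟩ := exists_joins_family hs hA k
  obtain ⟨c, h1, h2, h3⟩ := Joins.exists_of_perm (s := s) (cyc.nodup (k := k) 0) (by simpa using hs)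
    (cyc.perm a 0)
  rw [cyc.length_eq] at h2 h3
  refine ⟨F.image fun w => cyc k 0 a ++ (c ++ w), ?_, ?_⟩
  · rw [Finset.card_image_of_injective]
    · calc ((k - s) ^ m) ^ k ≤ ((m + 1) ^ k * #A) ^ k := Nat.pow_le_pow_left hc k
        _ = ((m + 1) ^ k) ^ k * #A ^ k := mul_pow _ _ _
        _ ≤ _ := Nat.mul_le_mul_left _ hF
    · intro w w' h
      simpa using h
  · intro y hy
    obtain ⟨w, hwF, rfl⟩ := Finset.mem_image.1 hy
    obtain ⟨h4, h5, h6⟩ := hw w hwF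
    have hlen : (cyc k 0 a ++ (c ++ w)).length = k * (m + k * k + 2 * k) + a := by
      simp only [List.length_append, cyc.length_eq, h2, h5]; ring
    refine ⟨?_, hlen, fun x => ?_⟩
    · rw [cyc.self_eq] at h4
      have h7 := (h4.trans (by simp; omega) h1).trans (by simp; omega)
        (cyc.joins_extra (s := s) (a := a) (by omega))
      exact h7
    · rw [hlen, cyc.count_mul_add, List.count_append, List.count_append, h3, h6, cyc.count_eq_one]
      have hsum : ∑ i ∈ range k, v (x - i) = m := by
        rw [← hv, ← Equiv.sum_comp (Equiv.subLeft x) v]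
        refine Finset.sum_bij (fun i _ => (i : ZMod k)) (fun _ _ => mem_univ _) ?_ ?_ ?_
        · intro i hi j hj hij
          rw [ZMod.natCast_eq_natCast_iff'] at hij
          rwa [Nat.mod_eq_of_lt (mem_range.1 hi), Nat.mod_eq_of_lt (mem_range.1 hj)] at hij
        · intro y _
          exact ⟨y.val, mem_range.2 (ZMod.val_lt y), ZMod.natCast_zmod_val y⟩
        · intro i _
          rfl
      rw [hsum]
      ring

end Blocks

theorem natCast_inj_of_lt {n a b : ℕ} (ha : a < n) (hb : b < n) (h : (a : ZMod n) = (b : ZMod n)) :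
    a = b := by
  rwa [ZMod.natCast_eq_natCast_iff', Nat.mod_eq_of_lt ha, Nat.mod_eq_of_lt hb] at h

section Colorings

variable {n k r : ℕ} [NeZero n]

/-- The part of the balanced complete `k`-partite `r`-graph containing a vertex. -/
def part (n k : ℕ) (x : ZMod n) : ZMod k := (x.val : ZMod k)

/-- Any `r` cyclically consecutive vertices receive distinct colors. -/
def CyclicProper {α : Type*} (r : ℕ) (f : ZMod n → α) : Prop :=
  ∀ (i : ZMod n) (d : ℕ), 0 < d → d < r → f i ≠ f (i + (d : ZMod n))

theorem rset_subset_TEdges (π : Equiv.Perm (ZMod n))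
    (h : CyclicProper r fun i => part n k (π i)) : rset n r π ⊆ TEdges n k r := by
  intro e he
  obtain ⟨i, -, rfl⟩ := Finset.mem_image.1 he
  have hlt : ∀ a b : Fin r, a < b →
      part n k (π (i + (a.val : ZMod n))) ≠ part n k (π (i + (b.val : ZMod n))) := by
    intro a b hab
    have hab' : a.val < b.val := hab
    have := h (i + (a.val : ZMod n)) (b.val - a.val) (by omega) (by omega)
    rwa [add_assoc, ← Nat.cast_add, Nat.add_sub_cancel' hab'.le] at this
  have hne : ∀ a b : Fin r, a ≠ b →
      part n k (π (i + (a.val : ZMod n))) ≠ part n k (π (i + (b.val : ZMod n))) := by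
    intro a b hab
    rcases lt_or_gt_of_ne hab with h' | h'
    · exact hlt a b h'
    · exact (hlt b a h').symm
  rw [TEdges, Finset.mem_filter, Finset.mem_powersetCard]
  refine ⟨⟨Finset.subset_univ _, ?_⟩, ?_⟩
  · rw [Finset.card_image_of_injective, Finset.card_univ, Fintype.card_fin]
    intro a b hab
    by_contra hcon
    exact hne a b hcon (congrArg (part n k) hab)
  · intro x hx y hy hxy
    obtain ⟨a, -, rfl⟩ := Finset.mem_image.1 hx
    obtain ⟨b, -, rfl⟩ := Finset.mem_image.1 hy
    have := hne a b (by rintro rfl; exact hxy rfl)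
    rwa [part, part, Ne, ZMod.natCast_eq_natCast_iff'] at this

/-- A permutation is determined by its `r`-set and its first `r` values. -/
theorem eq_of_rset_eq (hr : 3 ≤ r) (hrn : 2 * r ≤ n) {π σ : Equiv.Perm (ZMod n)}
    (h : rset n r π = rset n r σ) (h0 : ∀ j < r, π (j : ZMod n) = σ (j : ZMod n)) : π = σ := by
  have key : ∀ t : ℕ, t < n → π (t : ZMod n) = σ (t : ZMod n) := by
    intro t
    induction t using Nat.strong_induction_on with
    | _ t ih =>
    intro htn
    by_cases htr : t < r
    · exact h0 t htr
    have hmem : Finset.image (fun j : Fin r => π (((t - r + 1 : ℕ) : ZMod n) + (j.val : ZMod n)))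
        univ ∈ rset n r σ := by
      rw [← h]
      exact Finset.mem_image_of_mem _ (mem_univ _)
    obtain ⟨i, -, hi⟩ := Finset.mem_image.1 hmem
    rw [Finset.ext_iff] at hi
    simp only [Finset.mem_image, Finset.mem_univ, true_and] at hi
    have hwin : ∀ z, (∃ a < r, σ (i + (a : ZMod n)) = z) ↔
        ∃ b < r, π ((t - r + 1 + b : ℕ) : ZMod n) = z := by
      intro z
      rw [show (∃ a < r, σ (i + (a : ZMod n)) = z) ↔ ∃ a : Fin r, σ (i + (a.val : ZMod n)) = z from
        ⟨fun ⟨a, ha, hz⟩ => ⟨⟨a, ha⟩, hz⟩, fun ⟨a, hz⟩ => ⟨a, a.2, hz⟩⟩, hi z]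
      simp only [Nat.cast_add (t - r + 1)]
      exact ⟨fun ⟨a, hz⟩ => ⟨a, a.2, hz⟩, fun ⟨a, ha, hz⟩ => ⟨⟨a, ha⟩, hz⟩⟩
    obtain ⟨a, ha, hza⟩ := (hwin (σ ((t - r + 1 : ℕ) : ZMod n))).2
      ⟨0, by omega, ih _ (by omega) (by omega)⟩
    obtain ⟨b, hb, hzb⟩ := (hwin (σ ((t - 1 : ℕ) : ZMod n))).2
      ⟨r - 2, by omega, by
        rw [show t - r + 1 + (r - 2) = t - 1 by omega]
        exact ih _ (by omega) (by omega)⟩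
    have ha' := σ.injective hza
    have hb' := σ.injective hzb
    have hab : b = a + (r - 2) := by
      apply natCast_inj_of_lt (n := n) (by omega) (by omega)
      have : ((t - 1 : ℕ) : ZMod n) = ((t - r + 1 : ℕ) : ZMod n) + ((r - 2 : ℕ) : ZMod n) := by
        rw [← Nat.cast_add]; congr 1; omega
      rw [← ha', ← hb', add_assoc] at this
      rw [Nat.cast_add]
      exact add_left_cancel this
    have ha01 : a = 0 ∨ a = 1 := by omega
    rcases ha01 with rfl | rfl
    · rw [Nat.cast_zero, add_zero] at ha'
      obtain ⟨c, hc, hzc⟩ := (hwin (π (t : ZMod n))).2 ⟨r - 1, by omega, by congr 2; omega⟩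
      rw [ha', ← Nat.cast_add] at hzc
      by_cases hcr : c = r - 1
      · rw [← hzc]; congr 2; omega
      · rw [← ih _ (by omega) (by omega)] at hzc
        have := natCast_inj_of_lt (by omega) htn (π.injective hzc)
        omega
    · have hi' : i = ((t - r : ℕ) : ZMod n) := by
        rw [Nat.cast_add] at ha'
        exact add_right_cancel ha'
      obtain ⟨c, hc, hzc⟩ := (hwin (σ ((t - r : ℕ) : ZMod n))).1
        ⟨0, by omega, by rw [hi', Nat.cast_zero, add_zero]⟩
      rw [← ih _ (by omega) (by omega)] at hzc
      have := natCast_inj_of_lt (by omega) (by omega) (π.injective hzc)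
      omega
  ext x : 1
  rw [← ZMod.natCast_zmod_val x]
  exact key _ (ZMod.val_lt x)

theorem card_perms_le_card_hamCycles_mul (hr : 3 ≤ r) (hrn : 2 * r ≤ n)
    (G : Finset (Finset (ZMod n))) :
    #{π : Equiv.Perm (ZMod n) | rset n r π ⊆ G} ≤ n ^ r * #(hamCycles n r G) := by
  refine Finset.card_le_mul_card_image _ _ fun S _ => ?_
  calc _ ≤ #(univ : Finset (Fin r → ZMod n)) := by
        refine Finset.card_le_card_of_injOn (fun π j => π (j.val : ZMod n))
          (fun _ _ => mem_univ _) ?_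
        intro π hπ σ hσ he
        simp only [coe_filter, Finset.mem_filter, Finset.mem_univ, true_and,
          Set.mem_ofPred_eq] at hπ hσ
        exact eq_of_rset_eq hr hrn (hπ.2.trans hσ.2.symm) fun j hj => congrFun he ⟨j, hj⟩
    _ = n ^ r := by simp

theorem exists_perm_of_card_fiber_eq {ι α : Type*} [Fintype ι] [DecidableEq α] {f g : ι → α}
    (h : ∀ x, #{i | f i = x} = #{i | g i = x}) : ∃ π : Equiv.Perm ι, ∀ i, g (π i) = f i := by
  have e : ∀ x, Nonempty ({ i // f i = x } ≃ { i // g i = x }) := fun x => by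
    rw [← Fintype.card_eq, Fintype.card_subtype, Fintype.card_subtype]
    exact h x
  exact ⟨Equiv.ofFiberEquiv fun x => (e x).some, Equiv.ofFiberEquiv_map _⟩

/-- Every rearrangement of `g` is induced by at least `|ι|! / |α| ^ |ι|` permutations. -/
theorem factorial_le_card_perms {ι α : Type*} [Fintype ι] [DecidableEq ι] [Fintype α]
    [DecidableEq α] (g : ι → α) (σ : Equiv.Perm ι) :
    (Fintype.card ι).factorial ≤
      #{π : Equiv.Perm ι | g ∘ π = g ∘ σ} * Fintype.card α ^ Fintype.card ι := by
  rw [← Fintype.card_perm, ← Finset.card_univ, ← Fintype.card_fun, ← Finset.card_univ (α := ι → α)]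
  refine Finset.card_le_mul_card_image_of_maps_to (f := fun π : Equiv.Perm ι => g ∘ π)
    (fun _ _ => mem_univ _) _ fun f _ => ?_
  by_cases hf : ∃ τ : Equiv.Perm ι, g ∘ τ = f
  · obtain ⟨τ, rfl⟩ := hf
    refine Finset.card_le_card_of_injOn (fun π => π * τ⁻¹ * σ) ?_ ?_
    · intro π hπ
      simp only [coe_filter, Finset.mem_univ, true_and, Set.mem_ofPred_eq] at hπ ⊢
      ext i
      have := congrFun hπ (τ⁻¹ (σ i))
      simpa using this
    · intro π _ π' _ h
      simpa using h
  · rw [Finset.filter_eq_empty_iff.2 fun π _ hπ => hf ⟨π, hπ⟩]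
    simp

/-- The cyclic coloring read off a word of length `n`. -/
def wordColoring (n : ℕ) [NeZero k] (w : List (ZMod k)) (i : ZMod n) : ZMod k := w.getD i.val 0

theorem card_wordColoring_fiber [NeZero k] {w : List (ZMod k)} (hw : w.length = n) (x : ZMod k) :
    #{i : ZMod n | wordColoring n w i = x} = w.count x := by
  have h : (List.finRange n).map (fun i => w.getD i.val 0) = w := by
    apply List.ext_getElem
    · simp [hw]
    · intro i h1 h2
      simp [h2]
  conv_rhs => rw [← h]
  rw [List.count, List.countP_map, List.countP_eq_length_filter]
  have h2 : #{i : Fin n | w.getD i.val 0 = x} = #{i : ZMod n | wordColoring n w i = x} := by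
    refine Finset.card_bij (fun i _ => ((i.val : ℕ) : ZMod n)) ?_ ?_ ?_
    · intro i hi
      simpa [wordColoring, ZMod.val_natCast, Nat.mod_eq_of_lt i.2] using hi
    · intro i _ j _ hij
      exact Fin.ext (natCast_inj_of_lt i.2 j.2 hij)
    · intro i hi
      refine ⟨⟨i.val, ZMod.val_lt i⟩, ?_, by simp⟩
      simpa [wordColoring] using hi
  rw [← h2, ← List.toFinset_card_of_nodup ((List.nodup_finRange n).filter _)]
  congr 1
  ext i
  simp

theorem wordColoring_cyc [NeZero k] : wordColoring n (cyc k 0 n) = part n k := by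
  ext i
  have := ZMod.val_lt i
  simp [wordColoring, part, cyc, this]

theorem cyclicProper_wordColoring [NeZero k] {s : ℕ} (hs : s < k) {w : List (ZMod k)}
    (hw : w.length = n) (hkn : k ≤ n) (h : Joins s (cyc k 0 k) w (cyc k 0 k)) :
    CyclicProper (s + 1) (wordColoring n w) := by
  obtain ⟨h1, rest, h2⟩ := h
  have key : ∀ (j : ℕ) (hj : j < (w ++ cyc k 0 k).length),
      (w ++ cyc k 0 k)[j] = wordColoring n w (j : ZMod n) := by
    intro j hj
    by_cases hjn : j < n
    · simp [wordColoring, ZMod.val_natCast, Nat.mod_eq_of_lt hjn, hw, hjn]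
    · obtain ⟨t, rfl⟩ := Nat.exists_eq_add_of_le (not_lt.1 hjn)
      have htk : t < k := by simp [hw] at hj; exact hj
      have htn : t < n := by omega
      have h3 : (w ++ cyc k 0 k)[t]'(by simp; omega) = (cyc k 0 k)[t]'(by simpa) := by
        simp only [← h2]
        rw [List.getElem_append_left]
      rw [List.getElem_append_left (by omega)] at h3
      rw [List.getElem_append_right (by omega)]
      simp only [hw, Nat.add_sub_cancel_left]
      rw [← h3]
      simp [wordColoring, ZMod.val_natCast, Nat.mod_eq_of_lt htn, hw, htn]
  intro i d hd hds
  have hi := ZMod.val_lt i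
  have hid : i.val + d < (w ++ cyc k 0 k).length := by simp [hw]; omega
  have hne := h1.getElem_ne hid hd (by omega)
  rw [key, key] at hne
  simpa using hne

end Colorings

theorem factorial_mul_le_card_hamCycles {k r : ℕ} (hr : 3 ≤ r) (hk : r < k) {n : ℕ} [NeZero n]
    (m a : ℕ) (hn : n = k * (m + k * k + 2 * k) + a) :
    ((k - (r - 1)) ^ m) ^ k * n.factorial ≤
      ((m + 1) ^ k) ^ k * (k ^ n * (n ^ r * #(hamCycles n r (TEdges n k r)))) := by
  have : NeZero k := ⟨by omega⟩
  have hkn : k * k ≤ n := by rw [hn]; nlinarith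
  have hkn' : 2 * k ≤ n := le_trans (Nat.mul_le_mul_right k (by omega)) hkn
  obtain ⟨F, hF, hw⟩ := exists_balanced_closed_words (k := k) (s := r - 1) (by omega) m a
  rw [← hn] at hw
  have hcount : n.factorial * #F ≤ #{π : Equiv.Perm (ZMod n) | rset n r π ⊆ TEdges n k r} * k ^ n := by
    have hσ : ∀ w ∈ F, ∃ σ : Equiv.Perm (ZMod n), part n k ∘ σ = wordColoring n w := by
      intro w hwF
      obtain ⟨h1, h2, h3⟩ := hw w hwF
      obtain ⟨σ, hσ⟩ := exists_perm_of_card_fiber_eq (f := wordColoring n w) (g := part n k)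
        (fun x => by
          rw [← wordColoring_cyc, card_wordColoring_fiber h2,
            card_wordColoring_fiber (by simp), h3, h2])
      exact ⟨σ, funext hσ⟩
    have hfib : ∀ w ∈ F, n.factorial ≤
        #{π : Equiv.Perm (ZMod n) | part n k ∘ π = wordColoring n w} * k ^ n := by
      intro w hwF
      obtain ⟨σ, hσ⟩ := hσ w hwF
      have := factorial_le_card_perms (part n k) σ
      rwa [ZMod.card, ZMod.card, hσ] at this
    have hdisj : (F : Set (List (ZMod k))).PairwiseDisjoint fun w =>
        ({π : Equiv.Perm (ZMod n) | part n k ∘ π = wordColoring n w} : Finset _) := by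
      intro w hwF w' hwF' hne
      refine Finset.disjoint_left.2 fun π hπ hπ' => hne ?_
      simp only [Finset.mem_filter, Finset.mem_univ, true_and] at hπ hπ'
      have h1 := (hw w hwF).2.1
      have h2 := (hw w' hwF').2.1
      refine List.ext_getElem (h1.trans h2.symm) fun i hi hi' => ?_
      have := congrFun (hπ.symm.trans hπ') (i : ZMod n)
      simpa [wordColoring, ZMod.val_natCast, Nat.mod_eq_of_lt (h1 ▸ hi), hi, hi'] using this
    calc n.factorial * #F = ∑ w ∈ F, n.factorial := by simp [mul_comm]
      _ ≤ ∑ w ∈ F, #{π : Equiv.Perm (ZMod n) | part n k ∘ π = wordColoring n w} * k ^ n :=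
          Finset.sum_le_sum hfib
      _ = #(F.biUnion fun w => ({π : Equiv.Perm (ZMod n) | part n k ∘ π = wordColoring n w} :
            Finset _)) * k ^ n := by rw [Finset.card_biUnion hdisj, Finset.sum_mul]
      _ ≤ _ := by
          refine Nat.mul_le_mul_right _ (Finset.card_le_card fun π hπ => ?_)
          obtain ⟨w, hwF, hπ⟩ := Finset.mem_biUnion.1 hπ
          simp only [Finset.mem_filter, Finset.mem_univ, true_and] at hπ ⊢
          refine rset_subset_TEdges π ?_
          change CyclicProper r (part n k ∘ π)
          rw [hπ]
          have := cyclicProper_wordColoring (by omega) (hw w hwF).2.1 (by omega) (hw w hwF).1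
          rwa [Nat.sub_add_cancel (by omega)] at this
  have hham := card_perms_le_card_hamCycles_mul (n := n) hr (by omega) (TEdges n k r)
  calc _ ≤ ((m + 1) ^ k) ^ k * #F * n.factorial := Nat.mul_le_mul_right _ hF
    _ = ((m + 1) ^ k) ^ k * (n.factorial * #F) := by ring
    _ ≤ ((m + 1) ^ k) ^ k * (#{π : Equiv.Perm (ZMod n) | rset n r π ⊆ TEdges n k r} * k ^ n) :=
        Nat.mul_le_mul_left _ hcount
    _ ≤ ((m + 1) ^ k) ^ k * (n ^ r * #(hamCycles n r (TEdges n k r)) * k ^ n) :=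
        Nat.mul_le_mul_left _ (Nat.mul_le_mul_right _ hham)
    _ = _ := by ring

theorem pow_mul_factorial_le_card_hamCycles {k r : ℕ} (hr : 3 ≤ r) (hk : r < k) {n : ℕ} [NeZero n]
    (hn : k * (k * k + 2 * k) ≤ n) :
    (k - r + 1) ^ n * (n - 1).factorial ≤
      (k - r + 1) ^ (k * (k * k + 2 * k) + k) * n ^ (k * k + r) *
        (k ^ n * #(hamCycles n r (TEdges n k r))) := by
  set C := k * k + 2 * k with hC
  have hkpos : 0 < k := by omega
  have hCM : C ≤ n / k := (Nat.le_div_iff_mul_le hkpos).2 (by rwa [mul_comm])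
  obtain ⟨m, hm⟩ := Nat.exists_eq_add_of_le' hCM
  have hdiv := Nat.div_add_mod n k
  have hmod := Nat.mod_lt n hkpos
  rw [hm] at hdiv
  have hmn : m + 1 ≤ n := by
    have : 1 ≤ C := by omega
    have := Nat.le_mul_of_pos_left (m + C) hkpos
    omega
  have key := factorial_mul_le_card_hamCycles hr hk m (n % k) (by rw [add_assoc, ← hC, hdiv])
  rw [show k - (r - 1) = k - r + 1 by omega] at key
  set q := k - r + 1 with hq
  have hqpos : 0 < q := by omega
  set H := #(hamCycles n r (TEdges n k r))
  calc q ^ n * (n - 1).factorial ≤ q ^ (k * C + k + m * k) * n.factorial :=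
        Nat.mul_le_mul (Nat.pow_le_pow_right hqpos (by nlinarith))
          (Nat.factorial_le (Nat.sub_le n 1))
    _ = q ^ (k * C + k) * ((q ^ m) ^ k * n.factorial) := by rw [pow_add, pow_mul]; ring
    _ ≤ q ^ (k * C + k) * (((m + 1) ^ k) ^ k * (k ^ n * (n ^ r * H))) :=
        Nat.mul_le_mul_left _ key
    _ ≤ q ^ (k * C + k) * ((n ^ k) ^ k * (k ^ n * (n ^ r * H))) := by gcongr
    _ = _ := by rw [← pow_mul, pow_add n]; ring

theorem pow_mul_pow_le_rpow_sqrt {q : ℝ} (hq : 2 ≤ q) {n : ℕ} (hn : 1 ≤ n) (K D : ℕ) :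
    q ^ K * (n : ℝ) ^ D ≤ q ^ ((K + 2 * D : ℝ) * √n) := by
  have hx : 1 ≤ √(n : ℝ) := Real.one_le_sqrt.2 (by exact_mod_cast hn)
  have hq0 : 0 < q := by linarith
  have h1 : √(n : ℝ) ≤ q ^ √(n : ℝ) := by
    have h := one_add_mul_self_le_rpow_one_add (s := (1 : ℝ)) (by norm_num) hx
    have h' : ((1 : ℝ) + 1) ^ √(n : ℝ) ≤ q ^ √(n : ℝ) :=
      Real.rpow_le_rpow (by norm_num) (by linarith) (by linarith)
    linarith
  have h2 : (n : ℝ) ≤ (q ^ √(n : ℝ)) ^ 2 := by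
    rw [← Real.sq_sqrt (Nat.cast_nonneg (α := ℝ) n)]
    simpa using pow_le_pow_left₀ (Real.sqrt_nonneg _) h1 2
  have h3 : q ^ K ≤ (q ^ √(n : ℝ)) ^ K := by
    refine pow_le_pow_left₀ hq0.le ?_ K
    simpa using Real.rpow_le_rpow_of_exponent_le (by linarith : 1 ≤ q) hx
  calc q ^ K * (n : ℝ) ^ D ≤ (q ^ √(n : ℝ)) ^ K * ((q ^ √(n : ℝ)) ^ 2) ^ D := by gcongr
    _ = (q ^ √(n : ℝ)) ^ (K + 2 * D) := by rw [← pow_mul, pow_add]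
    _ = _ := by
      rw [← Real.rpow_natCast, ← Real.rpow_mul hq0.le]
      push_cast
      rw [mul_comm]

/-- For fixed `k > r ≥ 3`, the balanced complete `k`-partite `r`-graph satisfies
`H(T_r(n,k)) ≥ (1/2)·((k-r+1)/k)^n·(n-1)!·(k-r+1)^{-Θ(√n)}` for all large `n`. -/
theorem Tnk_ham_lower_bound (k r : ℕ) (hr : 3 ≤ r) (hk : r < k) :
    ∃ c : ℝ, 0 < c ∧ ∃ N : ℕ, ∀ (n : ℕ) [NeZero n], N ≤ n →
      ((hamCycles n r (TEdges n k r)).card : ℝ) ≥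
        (1 / 2) * (((k : ℝ) - r + 1) / (k : ℝ)) ^ n * (Nat.factorial (n - 1) : ℝ) *
          ((k : ℝ) - r + 1) ^ (-(c * Real.sqrt n)) := by
  set K := k * (k * k + 2 * k) + k with hK
  set D := k * k + r with hD
  refine ⟨K + 2 * D, by positivity, k * (k * k + 2 * k), fun n _ hn => ?_⟩
  have hq : (2 : ℝ) ≤ (k : ℝ) - r + 1 := by
    have : (r : ℝ) + 1 ≤ k := by exact_mod_cast hk
    linarith
  have hqc : ((k - r + 1 : ℕ) : ℝ) = (k : ℝ) - r + 1 := by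
    push_cast [Nat.cast_sub hk.le]; ring
  have h1 : (((k : ℝ) - r + 1) ^ n * ((n - 1).factorial : ℝ)) ≤
      ((k : ℝ) - r + 1) ^ K * (n : ℝ) ^ D * ((k : ℝ) ^ n * #(hamCycles n r (TEdges n k r))) := by
    have := pow_mul_factorial_le_card_hamCycles hr hk hn
    rw [← hqc]
    exact_mod_cast this
  have h2 := pow_mul_pow_le_rpow_sqrt hq (NeZero.one_le (n := n)) K D
  set q : ℝ := (k : ℝ) - r + 1
  set H : ℝ := (#(hamCycles n r (TEdges n k r)) : ℝ)
  have hkn : (0 : ℝ) < (k : ℝ) ^ n := pow_pos (by exact_mod_cast (by omega : 0 < k)) n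
  have hQ : 0 < q ^ ((K + 2 * D : ℝ) * √n) := Real.rpow_pos_of_pos (by linarith) _
  have h3 : q ^ n * ((n - 1).factorial : ℝ) ≤ q ^ ((K + 2 * D : ℝ) * √n) * ((k : ℝ) ^ n * H) :=
    h1.trans (mul_le_mul_of_nonneg_right h2 (by positivity))
  rw [Real.rpow_neg (by linarith), div_pow, ge_iff_le]
  calc _ = 1 / 2 * (q ^ n * ((n - 1).factorial : ℝ)) /
          (q ^ ((K + 2 * D : ℝ) * √n) * (k : ℝ) ^ n) := by field_simp
    _ ≤ H := by
      rw [div_le_iff₀ (by positivity)]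
      have : 0 ≤ q ^ n * ((n - 1).factorial : ℝ) := by
        have : 0 ≤ q := by linarith
        positivity
      linarith
end
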